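/- For all integers k, Δ ≥ 2 and every real ϱ > 0 there exist n_0 and ε_0 > 0 such that the following holds for all ε ≤ ε_0: if H is a (ϱ, 2, ε)-typical k-graph on n ≥ n_0 vertices, then H contains every tight k-tree T on n vertices with maximum 1-degree Δ_1(T) ≤ Δ. -/

import Mathlib

open Finset

attribute [local instance] Classical.propDecidable

variable {α : Type*}

/-- The degree of a vertex `v` in a hypergraph `T`: the number of edges containing `v`. -/
def vdeg [DecidableEq α] (T : Finset (Finset α)) (v : α) : ℕ :=
  (T.filter fun e => v ∈ e).card

/-- The vertex set of a hypergraph: the union of its edges. -/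
def hverts [DecidableEq α] (T : Finset (Finset α)) : Finset α := T.sup id

/-- The maximum 1-degree of a hypergraph. -/
def hmaxDeg [DecidableEq α] (T : Finset (Finset α)) : ℕ := (hverts T).sup (vdeg T)

/-- `es` is a valid ordering of the edges of a tight `k`-tree: every edge is a `k`-set, and
every edge except the first contains a vertex `v` not in any previous edge with the rest of
the edge contained in some previous edge. -/
def ValidOrdering [DecidableEq α] (k : ℕ) (es : List (Finset α)) : Prop :=
  (∀ e ∈ es, e.card = k) ∧
  ∀ i, 0 < i → i < es.length →
    ∃ v ∈ es.getD i ∅,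
      (∀ j, j < i → v ∉ es.getD j ∅) ∧
      ∃ j, j < i ∧ (es.getD i ∅) \ {v} ⊆ es.getD j ∅

/-- `T` is a tight `k`-tree: its edges admit a valid ordering. -/
def IsTightTree [DecidableEq α] (k : ℕ) (T : Finset (Finset α)) : Prop :=
  ∃ es : List (Finset α), es ≠ [] ∧ es.Nodup ∧ es.toFinset = T ∧ ValidOrdering k es

/-- `f` belongs to the shadow of the `k`-graph `H`. -/
def InShadow [DecidableEq α] (k : ℕ) (H : Finset (Finset α)) (f : Finset α) : Prop :=
  f.card = k - 1 ∧ ∃ e ∈ H, f ⊆ e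

/-- `H` contains (a copy of) `T`. -/
def Contains {β : Type*} [DecidableEq α] [DecidableEq β]
    (H : Finset (Finset α)) (T : Finset (Finset β)) : Prop :=
  ∃ φ : β → α, Function.Injective φ ∧ ∀ e ∈ T, e.image φ ∈ H

/-- The joint degree of a family `F` of `(k−1)`-sets in `H`: the number of vertices `v` such
that `f ∪ {v}` is an edge of `H` for every `f ∈ F`. -/
def jointDeg [Fintype α] [DecidableEq α] (H : Finset (Finset α)) (F : Finset (Finset α)) : ℕ :=
  (Finset.univ.filter fun v => ∀ f ∈ F, insert v f ∈ H).card

/-- The neighbourhood of a set `f` in `H`. -/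
def Nb {V : Type*} [Fintype V] [DecidableEq V] (H : Finset (Finset V)) (f : Finset V) : Finset V :=
  Finset.univ.filter fun v => insert v f ∈ H

lemma mem_Nb {V : Type*} [Fintype V] [DecidableEq V] {H : Finset (Finset V)} {f : Finset V} {v : V} :
    v ∈ Nb H f ↔ insert v f ∈ H := by simp [Nb]

lemma second_moment {V ι : Type*} [Fintype V] [DecidableEq V] (S : Finset ι) (N : ι → Finset V)
    (U : Finset V) (p η γ n : ℝ) (hp0 : 0 ≤ p) (hp1 : p ≤ 1) (hη0 : 0 ≤ η) (hη : 6 * η ≤ γ ^ 2)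
    (hγ : 0 < γ) (hn : n = Fintype.card V) (hn0 : 0 < n)
    (h1 : ∀ i ∈ S, (p - η) * n ≤ (N i).card)
    (h2 : ∀ i ∈ S, ∀ j ∈ S, i ≠ j → ((N i ∩ N j).card : ℝ) ≤ (p ^ 2 + η) * n)
    (h3 : ∀ i ∈ S, ((N i ∩ U).card : ℝ) ≤ p * U.card - γ * n) :
    (S.card : ℝ) * γ ^ 2 ≤ 2 := by
  classical
  set m : ℝ := (S.card : ℝ) with hm
  have hm0 : 0 ≤ m := by positivity
  let a : ι → V → ℝ := fun i v => if v ∈ N i then 1 else 0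
  let d : V → ℝ := fun v => ∑ i ∈ S, a i v
  have ha : ∀ (i : ι) (W : Finset V), ∑ v ∈ W, a i v = ((N i ∩ W).card : ℝ) := by
    intro i W
    simp only [a]
    rw [Finset.sum_ite_mem]
    simp [Finset.inter_comm]
  have hUn : (U.card : ℝ) ≤ n := by
    rw [hn]; exact_mod_cast Finset.card_le_univ U
  have hd1 : m * (p - η) * n ≤ ∑ v, d v := by
    simp only [d]
    rw [Finset.sum_comm]
    calc m * (p - η) * n = ∑ i ∈ S, (p - η) * n := by
          rw [Finset.sum_const, nsmul_eq_mul]; ring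
      _ ≤ _ := by
          apply Finset.sum_le_sum
          intro i hi
          rw [ha]; simpa using h1 i hi
  have hd2 : ∑ v, d v ^ 2 ≤ m * n + m ^ 2 * (p ^ 2 + η) * n := by
    have e1 : ∑ v, d v ^ 2 = ∑ i ∈ S, ∑ j ∈ S, ((N i ∩ N j).card : ℝ) := by
      simp only [d, sq, Finset.sum_mul_sum]
      rw [Finset.sum_comm]
      apply Finset.sum_congr rfl
      intro i _
      rw [Finset.sum_comm]
      apply Finset.sum_congr rfl
      intro j _
      rw [Finset.inter_comm, ← ha j (N i)]
      simp only [a]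
      simp
      congr 1
      ext v; simp [and_comm]
    rw [e1]
    have e2 : ∀ i ∈ S, ∑ j ∈ S, ((N i ∩ N j).card : ℝ) ≤ n + m * ((p ^ 2 + η) * n) := by
      intro i hi
      calc ∑ j ∈ S, ((N i ∩ N j).card : ℝ)
          ≤ ∑ j ∈ S, ((if i = j then n else 0) + (p ^ 2 + η) * n) := by
            apply Finset.sum_le_sum
            intro j hj
            split_ifs with hij
            · have : ((N i ∩ N j).card : ℝ) ≤ n := by
                rw [hn]; exact_mod_cast Finset.card_le_univ _
              have : 0 ≤ (p ^ 2 + η) * n := by positivity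
              linarith
            · simpa using h2 i hi j hj hij
        _ = _ := by
            rw [Finset.sum_add_distrib, Finset.sum_ite_eq, if_pos hi, Finset.sum_const, nsmul_eq_mul]
    calc _ ≤ ∑ i ∈ S, (n + m * ((p ^ 2 + η) * n)) := Finset.sum_le_sum e2
      _ = _ := by rw [Finset.sum_const, nsmul_eq_mul]; ring
  have hvar : ∑ v, (d v - p * m) ^ 2 ≤ m * n + 3 * η * m ^ 2 * n := by
    have : ∑ v, (d v - p * m) ^ 2 = ∑ v, d v ^ 2 - 2 * p * m * ∑ v, d v + (p * m) ^ 2 * n := by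
      simp only [sub_sq, Finset.sum_add_distrib, Finset.sum_sub_distrib, Finset.mul_sum]
      rw [Finset.sum_const, Finset.card_univ, nsmul_eq_mul, hn]
      have : ∀ v, 2 * d v * (p * m) = 2 * p * m * d v := fun v => by ring
      simp only [this]
      ring
    rw [this]
    have h5 : 2 * p * m * (m * (p - η) * n) ≤ 2 * p * m * ∑ v, d v :=
      mul_le_mul_of_nonneg_left hd1 (by positivity)
    have h6 : 2 * p * η * m ^ 2 * n ≤ 2 * η * m ^ 2 * n := by
      have : 0 ≤ 2 * η * m ^ 2 * n := by positivity
      nlinarith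
    nlinarith
  have hlow : m * γ * n ≤ ∑ v ∈ U, (p * m - d v) := by
    rw [Finset.sum_sub_distrib, Finset.sum_const, nsmul_eq_mul]
    have : ∑ v ∈ U, d v ≤ m * (p * U.card - γ * n) := by
      simp only [d]
      rw [Finset.sum_comm]
      calc _ ≤ ∑ i ∈ S, (p * U.card - γ * n) := by
            apply Finset.sum_le_sum
            intro i hi
            rw [ha]; exact h3 i hi
        _ = _ := by rw [Finset.sum_const, nsmul_eq_mul]
    linarith
  have hcs : (m * γ * n) ^ 2 ≤ n * (m * n + 3 * η * m ^ 2 * n) := by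
    calc (m * γ * n) ^ 2 ≤ (∑ v ∈ U, (p * m - d v)) ^ 2 :=
          pow_le_pow_left₀ (by positivity) hlow 2
      _ ≤ U.card * ∑ v ∈ U, (p * m - d v) ^ 2 := sq_sum_le_card_mul_sum_sq
      _ ≤ n * ∑ v, (p * m - d v) ^ 2 := by
          apply mul_le_mul hUn _ (Finset.sum_nonneg fun _ _ => sq_nonneg _) hn0.le
          exact Finset.sum_le_sum_of_subset_of_nonneg (Finset.subset_univ _)
            (fun _ _ _ => sq_nonneg _)
      _ = n * ∑ v, (d v - p * m) ^ 2 := by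
          congr 1; apply Finset.sum_congr rfl; intro v _; ring
      _ ≤ _ := mul_le_mul_of_nonneg_left hvar hn0.le
  have h7 : m ^ 2 * γ ^ 2 ≤ m + 3 * η * m ^ 2 := by
    have : n ^ 2 * (m ^ 2 * γ ^ 2) ≤ n ^ 2 * (m + 3 * η * m ^ 2) := by nlinarith
    exact le_of_mul_le_mul_left this (by positivity)
  by_contra hcon
  push Not at hcon
  have hmpos : 0 < m := by
    rcases hm0.eq_or_lt with h | h
    · rw [← h] at hcon; norm_num at hcon
    · exact h
  have h8 : 3 * η * m ^ 2 ≤ γ ^ 2 / 2 * m ^ 2 := by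
    apply mul_le_mul_of_nonneg_right _ (by positivity); linarith
  nlinarith

/-- `f` behaves as expected with respect to `U`. -/
def Good {V : Type*} [Fintype V] [DecidableEq V] (H : Finset (Finset V)) (ϱ γ n : ℝ)
    (U f : Finset V) : Prop :=
  |((U ∩ Nb H f).card : ℝ) - ϱ * U.card| ≤ γ * n

/-- The two-typicality assumption. -/
structure Typ {V : Type*} [Fintype V] [DecidableEq V] (H : Finset (Finset V)) (K : ℕ)
    (ϱ ε n : ℝ) : Prop where
  hn : n = Fintype.card V
  npos : 0 < n
  ϱ0 : 0 < ϱ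
  ϱ1 : ϱ ≤ 1
  ε0 : 0 < ε
  one : ∀ f : Finset V, f.card = K → |((Nb H f).card : ℝ) - ϱ * n| ≤ ε * n
  two : ∀ f f' : Finset V, f.card = K → f'.card = K → f ≠ f' →
    |((Nb H f ∩ Nb H f').card : ℝ) - ϱ ^ 2 * n| ≤ ε * n

lemma bad_card {V : Type*} [Fintype V] [DecidableEq V] {H : Finset (Finset V)} {K : ℕ}
    {ϱ ε n : ℝ} (hT : Typ H K ϱ ε n) (γ : ℝ) (hγ : 0 < γ) (hγ1 : γ ≤ 1) (hε : 24 * ε ≤ γ ^ 2)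
    (U : Finset V) :
    (((Finset.univ : Finset (Finset V)).filter
      fun f => f.card = K ∧ ¬ Good H ϱ γ n U f).card : ℝ) * γ ^ 2 ≤ 16 := by
  classical
  obtain ⟨hn, npos, ϱ0, ϱ1, ε0, one, two⟩ := hT
  set B1 := (Finset.univ : Finset (Finset V)).filter
    fun f => f.card = K ∧ ((Nb H f ∩ U).card : ℝ) ≤ ϱ * U.card - γ * n with hB1
  set B2 := (Finset.univ : Finset (Finset V)).filter
    fun f => f.card = K ∧ ((Nb H f ∩ Uᶜ).card : ℝ) ≤ ϱ * (Uᶜ).card - (γ / 2) * n with hB2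
  have hγε : ε ≤ γ / 2 := by nlinarith
  have c1 : (B1.card : ℝ) * γ ^ 2 ≤ 2 := by
    apply second_moment B1 (fun f => Nb H f) U ϱ ε γ n ϱ0.le ϱ1 ε0.le (by linarith) hγ hn npos
    · intro f hf
      have := (abs_le.mp (one f (by simp [hB1] at hf; exact hf.1))).1
      nlinarith
    · intro f hf f' hf' hne
      have := (abs_le.mp (two f f' (by simp [hB1] at hf; exact hf.1)
        (by simp [hB1] at hf'; exact hf'.1) hne)).2
      nlinarith
    · intro f hf
      simp only [hB1, Finset.mem_filter] at hf
      exact hf.2.2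
  have c2 : (B2.card : ℝ) * (γ / 2) ^ 2 ≤ 2 := by
    apply second_moment B2 (fun f => Nb H f) Uᶜ ϱ ε (γ / 2) n ϱ0.le ϱ1 ε0.le (by nlinarith)
      (by linarith) hn npos
    · intro f hf
      have := (abs_le.mp (one f (by simp [hB2] at hf; exact hf.1))).1
      nlinarith
    · intro f hf f' hf' hne
      have := (abs_le.mp (two f f' (by simp [hB2] at hf; exact hf.1)
        (by simp [hB2] at hf'; exact hf'.1) hne)).2
      nlinarith
    · intro f hf
      simp only [hB2, Finset.mem_filter] at hf
      exact hf.2.2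
  have hsub : ((Finset.univ : Finset (Finset V)).filter
      fun f => f.card = K ∧ ¬ Good H ϱ γ n U f) ⊆ B1 ∪ B2 := by
    intro f hf
    rw [Finset.mem_filter] at hf
    obtain ⟨-, hfK, hf⟩ := hf
    unfold Good at hf
    rw [Finset.mem_union]
    by_cases h : ((U ∩ Nb H f).card : ℝ) ≤ ϱ * U.card - γ * n
    · left
      simp only [hB1, Finset.mem_filter, Finset.mem_univ, true_and]
      exact ⟨hfK, by rw [Finset.inter_comm]; exact h⟩
    · right
      simp only [hB2, Finset.mem_filter, Finset.mem_univ, true_and]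
      refine ⟨hfK, ?_⟩
      have h' : ϱ * U.card + γ * n < ((U ∩ Nb H f).card : ℝ) := by
        by_contra hcon
        apply hf
        rw [abs_le]
        constructor <;> linarith
      have e1 : ((Nb H f ∩ Uᶜ).card : ℝ) + ((U ∩ Nb H f).card : ℝ) = (Nb H f).card := by
        have := Finset.card_sdiff_add_card_inter (Nb H f) U
        rw [Finset.inter_comm U, ← Finset.sdiff_eq_inter_compl]
        exact_mod_cast this
      have e2 : ((Uᶜ).card : ℝ) + U.card = n := by
        rw [hn]
        have := Finset.card_compl_add_card U
        exact_mod_cast this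
      have e3 := (abs_le.mp (one f hfK)).2
      have e4 : ((Uᶜ).card : ℝ) = n - U.card := by linarith
      rw [e4]
      nlinarith
  have hle : (((Finset.univ : Finset (Finset V)).filter
      fun f => f.card = K ∧ ¬ Good H ϱ γ n U f).card : ℝ) ≤ B1.card + B2.card := by
    have := (Finset.card_le_card hsub).trans (Finset.card_union_le _ _)
    exact_mod_cast this
  nlinarith [sq_nonneg γ]

lemma exp_count (q κ : ℝ) (hq : 0 < q) (hκ : 0 < κ) (D : ℕ) :
    ∀ᶠ n : ℕ in Filter.atTop, ∀ h m : ℕ, κ * n ≤ m → q ≤ 1 →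
      (1 / 2 : ℝ) ^ h ≤ (n : ℝ) ^ D * (1 - q) ^ m → q * κ / 2 * n ≤ h := by
  have hlim : ∀ᶠ x : ℝ in Filter.atTop, x ^ D ≤ Real.exp (q * κ / 2 * x) := by
    have := (isLittleO_pow_exp_pos_mul_atTop (k := D) (b := q * κ / 2) (by positivity)).bound
      (c := 1) one_pos
    filter_upwards [this, Filter.eventually_ge_atTop 0] with x hx hx0
    rw [one_mul, Real.norm_of_nonneg (by positivity), Real.norm_of_nonneg (Real.exp_pos _).le] at hx
    exact hx
  have := tendsto_natCast_atTop_atTop (R := ℝ) |>.eventually hlim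
  filter_upwards [this] with n hn h m hm hq1 hh
  have h1 : (1 - q) ^ m ≤ Real.exp (-(q * κ * n)) := by
    calc (1 - q) ^ m ≤ (Real.exp (-q)) ^ m := by
          apply pow_le_pow_left₀ (by linarith)
          have := Real.add_one_le_exp (-q); linarith
      _ = Real.exp (-(q * m)) := by rw [← Real.exp_nat_mul]; ring_nf
      _ ≤ _ := by
          apply Real.exp_le_exp.mpr
          nlinarith
  have h2 : (1 / 2 : ℝ) ^ h ≤ Real.exp (-(q * κ / 2 * n)) := by
    calc _ ≤ _ := hh
      _ ≤ Real.exp (q * κ / 2 * n) * Real.exp (-(q * κ * n)) :=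
          mul_le_mul hn h1 (pow_nonneg (by linarith) _) (Real.exp_pos _).le
      _ = _ := by rw [← Real.exp_add]; ring_nf
  have h3 : Real.exp (-(h : ℝ)) ≤ (1 / 2 : ℝ) ^ h := by
    have : Real.exp (-1) ≤ 1 / 2 := by
      rw [Real.exp_neg]
      have := Real.add_one_le_exp (1 : ℝ)
      rw [one_div]
      apply inv_anti₀ <;> linarith
    calc Real.exp (-(h : ℝ)) = Real.exp (-1) ^ h := by rw [← Real.exp_nat_mul]; ring_nf
      _ ≤ _ := pow_le_pow_left₀ (Real.exp_pos _).le this _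
  have := Real.exp_le_exp.mp (h3.trans h2)
  linarith

lemma hitting_set {V X : Type*} [Fintype V] [DecidableEq V] (𝒳 : Finset X) (W : X → Finset V)
    (a n : ℝ) (ha : 0 < a) (hn : n = Fintype.card V)
    (hW : ∀ x ∈ 𝒳, a * n ≤ (W x).card) (m : ℕ) (hm : (m : ℝ) ≤ a / 2 * n) (hm' : m ≤ Fintype.card V) :
    ∃ V1 : Finset V, V1.card = m ∧
      ∑ x ∈ 𝒳, (1 / 2 : ℝ) ^ (V1 ∩ W x).card ≤ 𝒳.card * (1 - a / 4) ^ m := by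
  classical
  induction m with
  | zero => exact ⟨∅, by simp⟩
  | succ m ih =>
    have hm1 : (m : ℝ) + 1 ≤ a / 2 * n := by exact_mod_cast hm
    obtain ⟨V1, hc, hs⟩ := ih (by linarith) (by omega)
    by_cases h𝒳 : 𝒳 = ∅
    · subst h𝒳
      obtain ⟨V2, -, h2⟩ := Finset.exists_subset_card_eq (s := (Finset.univ : Finset V))
        (n := m + 1) (by rw [Finset.card_univ]; exact hm')
      exact ⟨V2, h2, by simp⟩
    have ha1 : 1 - a / 4 ≥ 0 := by
      obtain ⟨x, hx⟩ := Finset.nonempty_iff_ne_empty.mpr h𝒳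
      have h1 := hW x hx
      have h2 : ((W x).card : ℝ) ≤ n := by
        rw [hn]; exact_mod_cast Finset.card_le_univ _
      have hn0 : 0 < n := by
        by_contra h
        push Not at h
        have : a / 2 * n ≤ 0 := mul_nonpos_of_nonneg_of_nonpos (by linarith) h
        have : (0 : ℝ) ≤ m := by positivity
        linarith
      have : a ≤ 1 := by
        by_contra h
        push Not at h
        nlinarith
      linarith
    have hne : (V1ᶜ).Nonempty := by
      rw [← Finset.card_pos, Finset.card_compl, hc]; omega
    have key : ∑ v ∈ V1ᶜ, ∑ x ∈ 𝒳, (1 / 2 : ℝ) ^ (insert v V1 ∩ W x).card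
        ≤ ∑ v ∈ V1ᶜ, (1 - a / 4) * ∑ x ∈ 𝒳, (1 / 2 : ℝ) ^ (V1 ∩ W x).card := by
      rw [Finset.sum_comm, Finset.sum_const, nsmul_eq_mul, Finset.mul_sum, Finset.mul_sum]
      apply Finset.sum_le_sum
      intro x hx
      have e1 : ∀ v ∈ V1ᶜ, (1 / 2 : ℝ) ^ (insert v V1 ∩ W x).card
          = (1 / 2 : ℝ) ^ (V1 ∩ W x).card * (1 - if v ∈ W x then 1 / 2 else 0) := by
        intro v hv
        rw [Finset.mem_compl] at hv
        split_ifs with hvx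
        · rw [Finset.insert_inter_of_mem hvx, Finset.card_insert_of_notMem (by simp [hv]), pow_succ]
          ring
        · rw [Finset.insert_inter_of_notMem hvx]; ring
      rw [Finset.sum_congr rfl e1, ← Finset.mul_sum, Finset.sum_sub_distrib, Finset.sum_const,
        ← Finset.sum_filter, Finset.sum_const, nsmul_eq_mul, nsmul_eq_mul]
      have e2 : a / 2 * n ≤ ((V1ᶜ.filter fun v => v ∈ W x).card : ℝ) := by
        have : (W x).card ≤ (V1ᶜ.filter fun v => v ∈ W x).card + V1.card := by
          rw [← Finset.card_sdiff_add_card_inter (W x) V1]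
          apply Nat.add_le_add
          · apply Finset.card_le_card; intro v; simp; tauto
          · apply Finset.card_le_card Finset.inter_subset_right
        have h' : ((W x).card : ℝ) ≤ (V1ᶜ.filter fun v => v ∈ W x).card + V1.card := by
          exact_mod_cast this
        rw [hc] at h'
        have := hW x hx
        linarith
      have e3 : ((V1ᶜ).card : ℝ) ≤ n := by
        rw [hn]; exact_mod_cast Finset.card_le_univ _
      have e4 : a / 2 * ((V1ᶜ).card : ℝ) ≤ ((V1ᶜ.filter fun v => v ∈ W x).card : ℝ) := by
        have := mul_le_mul_of_nonneg_left e3 (by linarith : 0 ≤ a / 2)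
        linarith
      have e5 : (0 : ℝ) ≤ (1 / 2 : ℝ) ^ (V1 ∩ W x).card := by positivity
      calc _ ≤ (1 / 2 : ℝ) ^ (V1 ∩ W x).card * ((V1ᶜ).card * (1 - a / 4)) := by
            apply mul_le_mul_of_nonneg_left _ e5
            nlinarith
        _ = _ := by ring
    obtain ⟨v, hv, hle⟩ := Finset.exists_le_of_sum_le hne key
    refine ⟨insert v V1, ?_, hle.trans ?_⟩
    · rw [Finset.card_insert_of_notMem (by simpa using hv), hc]
    · rw [pow_succ]
      calc _ ≤ (1 - a / 4) * (𝒳.card * (1 - a / 4) ^ m) := mul_le_mul_of_nonneg_left hs ha1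
        _ = _ := by ring
set_option linter.unusedSectionVars false
set_option linter.unusedDecidableInType false

/-- All parameters of the embedding process. -/
structure PData (V ι : Type*) where
  H : Finset (Finset V)
  K : ℕ
  r : ℕ
  Δ : ℕ
  N : ℕ
  M : ℕ
  ϱ : ℝ
  ε : ℝ
  γ : ℝ
  n : ℝ
  c : ℝ
  c1 : ℝ
  δ : ℝ
  P : ℕ → Option (Finset ℕ)
  Q : ℕ → Option (ι × Finset ℕ)
  V1 : Finset V
  I1 : Finset ι
  b : ι → ℕ

namespace PData

variable {V ι : Type*} [Fintype V] [DecidableEq V] [Fintype ι] [DecidableEq ι]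

/-- The current candidates of `x`. -/
noncomputable def NX (d : PData V ι) (φ : ℕ → V) (t : ℕ) (x : ι) : Finset V :=
  Finset.univ.filter fun u => ∀ s < t, ∀ A, d.Q s = some (x, A) →
    u ∈ Nb d.H (insert (φ s) (A.image φ))

/-- The times before `t` at which `x` is affected. -/
noncomputable def JS (d : PData V ι) (t : ℕ) (x : ι) : Finset ℕ :=
  (Finset.range t).filter fun s => ∃ A, d.Q s = some (x, A)

/-- The number of times before `t` at which `x` is affected. -/
noncomputable def jx (d : PData V ι) (t : ℕ) (x : ι) : ℕ := (d.JS t x).card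

/-- One factor of the potential function. -/
noncomputable def gx (d : PData V ι) (φ : ℕ → V) (t : ℕ) (x : ι) (u : V) : ℝ :=
  1 - if u ∈ d.NX φ t x then d.c ^ (d.r - d.jx t x) / 2 else 0

/-- The sets which have to be treated well when `x` is affected. -/
noncomputable def fam (d : PData V ι) (φ : ℕ → V) (t : ℕ) (x : ι) : Finset (Finset V) :=
  insert (d.NX φ t x) (insert (d.NX φ t x ∩ d.V1)
    ((Finset.univ.filter fun x' => d.b x' = d.b x).image fun x' => d.NX φ t x ∩ d.NX φ t x'))

structure Hyp (d : PData V ι) : Prop where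
  typ : Typ d.H d.K d.ϱ d.ε d.n
  γ0 : 0 < d.γ
  γ1 : d.γ ≤ 1
  εγ : 24 * d.ε ≤ d.γ ^ 2
  K1 : 1 ≤ d.K
  hP : ∀ t < d.N, ∀ f, d.P t = some f → f ⊆ Finset.range t ∧ f.card = d.K
  hQ : ∀ t < d.N, ∀ x A, d.Q t = some (x, A) → A ⊆ Finset.range t ∧ A.card + 1 = d.K
  hPm : ∀ f, ((Finset.range d.N).filter fun t => d.P t = some f).card ≤ d.Δ
  hQr : ∀ x, d.jx d.N x = d.r
  hb : ∀ x, (Finset.univ.filter fun x' => d.b x' = d.b x).card ≤ d.M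
  hV1 : ∀ f f' : Finset V, f.card = d.K → f'.card = d.K →
    d.c1 * d.n ≤ (d.V1 ∩ (Nb d.H f ∩ Nb d.H f')).card
  c0 : 0 < d.c
  cle : d.c ≤ 1
  hE : (d.r * d.I1.card + d.Δ * (16 / d.γ ^ 2)) + (d.M + 2) * (16 / d.γ ^ 2) + d.c * d.n
    ≤ d.c1 * d.n
  δ0 : 0 < d.δ
  hR : d.δ * d.n + d.γ * d.n ≤ d.ϱ * (d.n - d.V1.card - d.N)
  hE2 : (d.M + 2) * (16 / d.γ ^ 2) < d.δ * d.n

structure Inv (d : PData V ι) (t : ℕ) (φ : ℕ → V) : Prop where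
  inj : Set.InjOn φ (Finset.range t)
  edge : ∀ s < t, ∀ f, d.P s = some f → φ s ∈ Nb d.H (f.image φ)
  ha : ∀ x, d.ϱ ^ d.jx t x * d.n - d.jx t x * d.γ * d.n ≤ (d.NX φ t x).card
  hb : ∀ x x', x ≠ x' → d.b x' = d.b x → ((d.NX φ t x ∩ d.NX φ t x').card : ℝ) ≤
    d.ϱ ^ (d.jx t x + d.jx t x') * d.n + (d.jx t x + d.jx t x' : ℕ) * d.γ * d.n
  hc : ∀ x, d.ϱ ^ d.jx t x * d.V1.card - d.jx t x * d.γ * d.n ≤ (d.NX φ t x ∩ d.V1).card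
  hd : ∑ u ∈ ((Finset.range t).image φ)ᶜ, ∏ x ∈ d.I1, d.gx φ t x u ≤
    d.n * (1 - d.c ^ d.r / 2) ^ d.I1.card
  hg : ∀ s < t, φ s ∈ d.V1 → (∃ x ∈ d.I1, ∃ A, d.Q s = some (x, A)) ∨
    ∃ f, d.P s = some f ∧
      ((Nb d.H (f.image φ) ∩ (d.V1 ∪ (Finset.range t).image φ)ᶜ).card : ℝ) < d.δ * d.n

lemma jx_le (d : PData V ι) (hyp : d.Hyp) {t : ℕ} (ht : t ≤ d.N) (x : ι) : d.jx t x ≤ d.r := by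
  rw [← hyp.hQr x]
  apply Finset.card_le_card
  apply Finset.filter_subset_filter
  simpa using ht

lemma JS_succ_ne (d : PData V ι) (t : ℕ) (x : ι) (h : ∀ A, d.Q t ≠ some (x, A)) :
    d.JS (t + 1) x = d.JS t x := by
  unfold JS
  rw [Finset.range_add_one, Finset.filter_insert, if_neg]
  rintro ⟨A, hA⟩
  exact h A hA

lemma jx_succ_ne (d : PData V ι) (t : ℕ) (x : ι) (h : ∀ A, d.Q t ≠ some (x, A)) :
    d.jx (t + 1) x = d.jx t x := by
  unfold jx; rw [JS_succ_ne d t x h]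

lemma jx_succ_eq (d : PData V ι) (t : ℕ) (x : ι) (A) (h : d.Q t = some (x, A)) :
    d.jx (t + 1) x = d.jx t x + 1 := by
  unfold jx JS
  rw [Finset.range_add_one, Finset.filter_insert, if_pos ⟨A, h⟩, Finset.card_insert_of_notMem]
  simp

lemma gx_nonneg (d : PData V ι) (hyp : d.Hyp) (φ : ℕ → V) (t : ℕ) (x : ι) (u : V) :
    0 ≤ d.gx φ t x u := by
  unfold gx
  have : d.c ^ (d.r - d.jx t x) ≤ 1 := pow_le_one₀ hyp.c0.le hyp.cle
  split_ifs <;> linarith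

lemma bad_le (d : PData V ι) (hyp : d.Hyp) (U : Finset V) :
    (((Finset.univ : Finset (Finset V)).filter
      fun f => f.card = d.K ∧ ¬ Good d.H d.ϱ d.γ d.n U f).card : ℝ) ≤ 16 / d.γ ^ 2 := by
  rw [le_div_iff₀ (by have := hyp.γ0; positivity)]
  exact bad_card hyp.typ d.γ hyp.γ0 hyp.γ1 hyp.εγ U

lemma R_card (d : PData V ι) (hyp : d.Hyp) (φ : ℕ → V) {t : ℕ} (ht : t ≤ d.N) :
    d.n - d.V1.card - d.N ≤ ((d.V1 ∪ (Finset.range t).image φ)ᶜ.card : ℝ) := by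
  have h1 : (d.V1 ∪ (Finset.range t).image φ).card ≤ d.V1.card + d.N := by
    refine (Finset.card_union_le _ _).trans ?_
    have : ((Finset.range t).image φ).card ≤ t := by
      simpa using Finset.card_image_le (s := Finset.range t) (f := φ)
    omega
  have h2 := Finset.card_compl_add_card (d.V1 ∪ (Finset.range t).image φ)
  have h3 : ((d.V1 ∪ (Finset.range t).image φ)ᶜ.card : ℝ) +
    (d.V1 ∪ (Finset.range t).image φ).card = d.n := by
    rw [hyp.typ.hn]; exact_mod_cast h2
  have h4 : ((d.V1 ∪ (Finset.range t).image φ).card : ℝ) ≤ d.V1.card + d.N := by exact_mod_cast h1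
  linarith

lemma usedV1 (d : PData V ι) (hyp : d.Hyp) {φ : ℕ → V} {t : ℕ} (ht : t ≤ d.N) (inv : d.Inv t φ) :
    ((d.V1 ∩ (Finset.range t).image φ).card : ℝ) ≤
      d.r * d.I1.card + d.Δ * (16 / d.γ ^ 2) := by
  classical
  set R := (d.V1 ∪ (Finset.range t).image φ)ᶜ with hRdef
  set S1 := (Finset.range t).filter fun s => ∃ x ∈ d.I1, ∃ A, d.Q s = some (x, A) with hS1
  set S2 := (Finset.range t).filter fun s => ∃ f, d.P s = some f ∧
      ((Nb d.H (f.image φ) ∩ R).card : ℝ) < d.δ * d.n with hS2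
  have hsub : d.V1 ∩ (Finset.range t).image φ ⊆ (S1 ∪ S2).image φ := by
    intro u hu
    rw [Finset.mem_inter, Finset.mem_image] at hu
    obtain ⟨huV, s, hs, rfl⟩ := hu
    apply Finset.mem_image_of_mem
    rw [Finset.mem_union]
    rcases inv.hg s (Finset.mem_range.mp hs) huV with h | h
    · left; exact Finset.mem_filter.mpr ⟨hs, h⟩
    · right; exact Finset.mem_filter.mpr ⟨hs, h⟩
  have hc1 : S1.card ≤ d.I1.card * d.r := by
    have : S1 ⊆ d.I1.biUnion (d.JS t) := by
      intro s hs
      rw [hS1, Finset.mem_filter] at hs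
      obtain ⟨hs, x, hx, A, hA⟩ := hs
      rw [Finset.mem_biUnion]
      exact ⟨x, hx, Finset.mem_filter.mpr ⟨hs, A, hA⟩⟩
    refine (Finset.card_le_card this).trans (Finset.card_biUnion_le_card_mul _ _ _ ?_)
    intro x _
    exact jx_le d hyp ht x
  let F : ℕ → Finset V := fun s => ((d.P s).getD ∅).image φ
  have hc2 : S2.card ≤ d.Δ * (S2.image F).card := by
    apply Finset.card_le_mul_card_image
    intro a ha
    rw [Finset.mem_image] at ha
    obtain ⟨s0, hs0, rfl⟩ := ha
    rw [hS2, Finset.mem_filter] at hs0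
    obtain ⟨hs0, f0, hf0, -⟩ := hs0
    refine le_trans (Finset.card_le_card ?_) (hyp.hPm f0)
    intro s hs
    rw [Finset.mem_filter, hS2, Finset.mem_filter] at hs
    obtain ⟨⟨hs, f, hf, -⟩, heq⟩ := hs
    have hst := Finset.mem_range.mp hs
    have hs0t := Finset.mem_range.mp hs0
    rw [Finset.mem_filter, Finset.mem_range]
    refine ⟨by omega, ?_⟩
    simp only [F, hf, hf0, Option.getD_some] at heq
    rw [hf]
    congr 1
    have h1 := (hyp.hP s (by omega) f hf).1
    have h2 := (hyp.hP s0 (by omega) f0 hf0).1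
    have h1' : (f : Set ℕ) ⊆ (Finset.range t : Finset ℕ) := by
      have : f ⊆ Finset.range t := h1.trans (by simpa using hst.le)
      exact_mod_cast this
    have h2' : (f0 : Set ℕ) ⊆ (Finset.range t : Finset ℕ) := by
      have : f0 ⊆ Finset.range t := h2.trans (by simpa using hs0t.le)
      exact_mod_cast this
    have := (inv.inj.image_eq_image_iff h1' h2').mp (by
      have := congrArg (fun z : Finset V => (z : Set V)) heq
      simpa using this)
    exact_mod_cast this
  have hc3 : ((S2.image F).card : ℝ) ≤ 16 / d.γ ^ 2 := by
    refine le_trans ?_ (bad_le d hyp R)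
    norm_cast
    apply Finset.card_le_card
    intro g hg
    rw [Finset.mem_image] at hg
    obtain ⟨s, hs, rfl⟩ := hg
    rw [hS2, Finset.mem_filter] at hs
    obtain ⟨hs, f, hf, hlt⟩ := hs
    have hst := Finset.mem_range.mp hs
    have hfp := hyp.hP s (by omega) f hf
    rw [Finset.mem_filter]
    simp only [F, hf, Option.getD_some]
    refine ⟨Finset.mem_univ _, ?_, ?_⟩
    · rw [Finset.card_image_of_injOn, hfp.2]
      apply inv.inj.mono
      have : f ⊆ Finset.range t := hfp.1.trans (by simpa using hst.le)
      exact_mod_cast this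
    · unfold Good
      intro hgood
      have h1 := (abs_le.mp hgood).1
      rw [Finset.inter_comm] at h1
      have h2 := R_card d hyp φ ht
      have h3 := mul_le_mul_of_nonneg_left h2 hyp.typ.ϱ0.le
      have h4 := hyp.hR
      linarith
  have h5 : (d.V1 ∩ (Finset.range t).image φ).card ≤ S1.card + S2.card :=
    (Finset.card_le_card hsub).trans (Finset.card_image_le.trans (Finset.card_union_le _ _))
  have h6 : ((d.V1 ∩ (Finset.range t).image φ).card : ℝ) ≤ d.I1.card * d.r +
      d.Δ * (S2.image F).card := by
    have := h5.trans (Nat.add_le_add hc1 hc2)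
    exact_mod_cast this
  have h7 := mul_le_mul_of_nonneg_left hc3 (Nat.cast_nonneg (α := ℝ) d.Δ)
  linarith

lemma fam_card (d : PData V ι) (hyp : d.Hyp) (φ : ℕ → V) (t : ℕ) (x : ι) :
    (d.fam φ t x).card ≤ d.M + 2 := by
  unfold fam
  refine (Finset.card_insert_le _ _).trans ?_
  have h1 := Finset.card_insert_le (d.NX φ t x ∩ d.V1)
    ((Finset.univ.filter fun x' => d.b x' = d.b x).image fun x' => d.NX φ t x ∩ d.NX φ t x')
  have h2 : ((Finset.univ.filter fun x' => d.b x' = d.b x).image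
    fun x' => d.NX φ t x ∩ d.NX φ t x').card ≤ d.M := Finset.card_image_le.trans (hyp.hb x)
  omega

/-- Forbidden images at time `t`. -/
noncomputable def ES (d : PData V ι) (φ : ℕ → V) (t : ℕ) : Finset V :=
  Finset.univ.filter fun u => u ∉ (Finset.range t).image φ ∧ ∃ x A, d.Q t = some (x, A) ∧
    ∃ U ∈ d.fam φ t x, ¬ Good d.H d.ϱ d.γ d.n U (insert u (A.image φ))

lemma cardA (d : PData V ι) (hyp : d.Hyp) {φ : ℕ → V} {t : ℕ} (ht : t < d.N) (inv : d.Inv t φ)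
    {x A} (hA : d.Q t = some (x, A)) {u : V} (hu : u ∉ (Finset.range t).image φ) :
    u ∉ A.image φ ∧ (insert u (A.image φ)).card = d.K := by
  obtain ⟨h1, h2⟩ := hyp.hQ t ht x A hA
  have hnot : u ∉ A.image φ := fun h => hu (Finset.image_subset_image h1 h)
  refine ⟨hnot, ?_⟩
  rw [Finset.card_insert_of_notMem hnot, Finset.card_image_of_injOn, h2]
  exact inv.inj.mono (by exact_mod_cast h1)

lemma ES_card (d : PData V ι) (hyp : d.Hyp) {φ : ℕ → V} {t : ℕ} (ht : t < d.N)
    (inv : d.Inv t φ) : ((d.ES φ t).card : ℝ) ≤ (d.M + 2) * (16 / d.γ ^ 2) := by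
  classical
  have hpos : (0 : ℝ) ≤ 16 / d.γ ^ 2 := by have := hyp.γ0; positivity
  rcases hq : d.Q t with _ | ⟨x, A⟩
  · have : d.ES φ t = ∅ := by
      unfold ES; simp [hq]
    rw [this]; simp only [Finset.card_empty, Nat.cast_zero]; positivity
  · have hsub : d.ES φ t ⊆ (d.fam φ t x).biUnion fun U => Finset.univ.filter fun u =>
        u ∉ (Finset.range t).image φ ∧ ¬ Good d.H d.ϱ d.γ d.n U (insert u (A.image φ)) := by
      intro u hu
      unfold ES at hu
      rw [Finset.mem_filter] at hu
      obtain ⟨-, hu, x', A', hq', U, hU, hbad⟩ := hu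
      rw [hq] at hq'
      simp only [Option.some.injEq, Prod.mk.injEq] at hq'
      obtain ⟨rfl, rfl⟩ := hq'
      rw [Finset.mem_biUnion]
      exact ⟨U, hU, Finset.mem_filter.mpr ⟨Finset.mem_univ _, hu, hbad⟩⟩
    have h1 : ∀ U ∈ d.fam φ t x, ((Finset.univ.filter fun u =>
        u ∉ (Finset.range t).image φ ∧
          ¬ Good d.H d.ϱ d.γ d.n U (insert u (A.image φ))).card : ℝ) ≤ 16 / d.γ ^ 2 := by
      intro U _
      refine le_trans ?_ (bad_le d hyp U)
      norm_cast
      apply Finset.card_le_card_of_injOn (fun u => insert u (A.image φ))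
      · intro u hu
        rw [Finset.mem_coe, Finset.mem_filter] at hu
        rw [Finset.mem_coe, Finset.mem_filter]
        exact ⟨Finset.mem_univ _, (cardA d hyp ht inv hq hu.2.1).2, hu.2.2⟩
      · intro u hu u' hu' heq
        rw [Finset.mem_coe, Finset.mem_filter] at hu hu'
        have h := (cardA d hyp ht inv hq hu.2.1).1
        have heq' : insert u (A.image φ) = insert u' (A.image φ) := heq
        have : u ∈ insert u' (A.image φ) := heq' ▸ Finset.mem_insert_self u _
        rw [Finset.mem_insert] at this
        tauto
    have h2 : ((d.ES φ t).card : ℝ) ≤ ∑ U ∈ d.fam φ t x, ((Finset.univ.filter fun u =>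
        u ∉ (Finset.range t).image φ ∧
          ¬ Good d.H d.ϱ d.γ d.n U (insert u (A.image φ))).card : ℝ) := by
      have := (Finset.card_le_card hsub).trans Finset.card_biUnion_le
      exact_mod_cast this
    refine h2.trans ((Finset.sum_le_sum h1).trans ?_)
    rw [Finset.sum_const, nsmul_eq_mul]
    apply mul_le_mul_of_nonneg_right _ hpos
    exact_mod_cast fam_card d hyp φ t x

/-- Vertices allowed by the edge born at time `t`. -/
noncomputable def cand (d : PData V ι) (φ : ℕ → V) (t : ℕ) : Finset V :=
  Finset.univ.filter fun u => ∀ f, d.P t = some f → u ∈ Nb d.H (f.image φ)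

lemma cardP (d : PData V ι) (hyp : d.Hyp) {φ : ℕ → V} {t : ℕ} (ht : t < d.N) (inv : d.Inv t φ)
    {f} (hf : d.P t = some f) : (f.image φ).card = d.K := by
  obtain ⟨h1, h2⟩ := hyp.hP t ht f hf
  rw [Finset.card_image_of_injOn, h2]
  exact inv.inj.mono (by exact_mod_cast h1)

lemma cand_V1 (d : PData V ι) (hyp : d.Hyp) {φ : ℕ → V} {t : ℕ} (ht : t < d.N) (inv : d.Inv t φ)
    (f' : Finset V) (hf' : f'.card = d.K) :
    d.c * d.n ≤ ((((d.V1 ∩ d.cand φ t) \ (Finset.range t).image φ) \ d.ES φ t) ∩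
      Nb d.H f').card := by
  classical
  have h0 : d.c1 * d.n ≤ (d.V1 ∩ (d.cand φ t ∩ Nb d.H f')).card := by
    rcases hp : d.P t with _ | f
    · have : d.cand φ t = Finset.univ := by unfold cand; simp [hp]
      rw [this, Finset.univ_inter]
      simpa using hyp.hV1 f' f' hf' hf'
    · have : d.cand φ t = Nb d.H (f.image φ) := by
        unfold cand; ext u; simp [hp]
      rw [this]
      exact hyp.hV1 _ f' (cardP d hyp ht inv hp) hf'
  have h1 : d.V1 ∩ (d.cand φ t ∩ Nb d.H f') ⊆
      (((((d.V1 ∩ d.cand φ t) \ (Finset.range t).image φ) \ d.ES φ t) ∩ Nb d.H f') ∪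
        (d.V1 ∩ (Finset.range t).image φ)) ∪ d.ES φ t := by
    intro u hu
    simp only [Finset.mem_inter, Finset.mem_union, Finset.mem_sdiff] at hu ⊢
    tauto
  have h2 := (Finset.card_le_card h1).trans ((Finset.card_union_le _ _).trans
    (Nat.add_le_add_right (Finset.card_union_le _ _) _))
  have h3 : ((d.V1 ∩ (d.cand φ t ∩ Nb d.H f')).card : ℝ) ≤
     ((((d.V1 ∩ d.cand φ t) \ (Finset.range t).image φ) \ d.ES φ t) ∩
      Nb d.H f').card + (d.V1 ∩ (Finset.range t).image φ).card + (d.ES φ t).card := by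
    exact_mod_cast h2
  have h4 := usedV1 d hyp ht.le inv
  have h5 := ES_card d hyp ht inv
  have h6 := hyp.hE
  linarith

end PData
namespace PData

variable {V ι : Type*} [Fintype V] [DecidableEq V] [Fintype ι] [DecidableEq ι]

lemma choose_avg (d : PData V ι) (hyp : d.Hyp) {φ : ℕ → V} {t : ℕ} (ht : t < d.N)
    (inv : d.Inv t φ) (x : ι) (A : Finset ℕ) (hQ : d.Q t = some (x, A))
    (W : V → ℝ) (hW : ∀ u, 0 ≤ W u) :
    ∃ y ∈ ((d.V1 ∩ d.cand φ t) \ (Finset.range t).image φ) \ d.ES φ t,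
      ∑ u ∈ ((Finset.range t).image φ)ᶜ, W u *
        (1 - if u ∈ d.NX φ t x ∩ Nb d.H (insert y (A.image φ)) then
          d.c ^ (d.r - (d.jx t x + 1)) / 2 else 0) ≤
      ∑ u ∈ ((Finset.range t).image φ)ᶜ, W u * d.gx φ t x u := by
  classical
  set Y := ((d.V1 ∩ d.cand φ t) \ (Finset.range t).image φ) \ d.ES φ t with hY
  have hcn : 0 < d.c * d.n := mul_pos hyp.c0 hyp.typ.npos
  have hYn : (Y.card : ℝ) ≤ d.n := by
    rw [hyp.typ.hn]; exact_mod_cast Finset.card_le_univ _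
  have hj : d.jx t x + 1 ≤ d.r := by
    rw [← jx_succ_eq d t x A hQ]
    exact jx_le d hyp ht x
  have hmany : ∀ u ∉ (Finset.range t).image φ,
      d.c * d.n ≤ (Y.filter fun y => u ∈ Nb d.H (insert y (A.image φ))).card := by
    intro u hu
    have h1 := cand_V1 d hyp ht inv (insert u (A.image φ)) (cardA d hyp ht inv hQ hu).2
    refine h1.trans ?_
    norm_cast
    apply Finset.card_le_card
    intro y hy
    rw [Finset.mem_inter, mem_Nb] at hy
    rw [Finset.mem_filter, mem_Nb, Finset.insert_comm]
    exact hy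
  by_cases hex : ∃ u, u ∉ (Finset.range t).image φ
  · have hne : Y.Nonempty := by
      obtain ⟨u, hu⟩ := hex
      have h1 := hmany u hu
      have h2 : 0 < ((Y.filter fun y => u ∈ Nb d.H (insert y (A.image φ))).card : ℝ) := by linarith
      have h3 := Finset.card_pos.mp (by exact_mod_cast h2)
      exact h3.mono (Finset.filter_subset _ _)
    have key : ∑ y ∈ Y, ∑ u ∈ ((Finset.range t).image φ)ᶜ, W u *
        (1 - if u ∈ d.NX φ t x ∩ Nb d.H (insert y (A.image φ)) then
          d.c ^ (d.r - (d.jx t x + 1)) / 2 else 0) ≤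
      ∑ y ∈ Y, ∑ u ∈ ((Finset.range t).image φ)ᶜ, W u * d.gx φ t x u := by
      rw [Finset.sum_comm, Finset.sum_comm (s := Y)]
      apply Finset.sum_le_sum
      intro u hu
      rw [Finset.mem_compl] at hu
      rw [← Finset.mul_sum, ← Finset.mul_sum]
      apply mul_le_mul_of_nonneg_left _ (hW u)
      rw [Finset.sum_const, nsmul_eq_mul]
      unfold gx
      by_cases huN : u ∈ d.NX φ t x
      · simp only [Finset.mem_inter, huN, true_and, if_true]
        rw [Finset.sum_sub_distrib, Finset.sum_const, ← Finset.sum_filter, Finset.sum_const,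
          nsmul_eq_mul, nsmul_eq_mul]
        have h1 := hmany u hu
        have h2 : d.c * Y.card ≤ (Y.filter fun y => u ∈ Nb d.H (insert y (A.image φ))).card :=
          (mul_le_mul_of_nonneg_left hYn hyp.c0.le).trans h1
        have h3 : d.r - d.jx t x = (d.r - (d.jx t x + 1)) + 1 := by omega
        rw [h3, pow_succ]
        have h4 : 0 ≤ d.c ^ (d.r - (d.jx t x + 1)) := pow_nonneg hyp.c0.le _
        have h5 := mul_le_mul_of_nonneg_right h2 h4
        nlinarith
      · simp [huN]
    exact Finset.exists_le_of_sum_le hne key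
  · push Not at hex
    exfalso
    have h1 : (Finset.univ : Finset V) ⊆ (Finset.range t).image φ := fun u _ => hex u
    have h2 : ((d.V1 ∪ (Finset.range t).image φ)ᶜ.card : ℝ) ≤ 0 := by
      norm_cast
      rw [Nat.le_zero, Finset.card_eq_zero]
      ext u; simpa using fun _ => by simpa using hex u
    have h3 := R_card d hyp φ ht.le
    have h4 := hyp.hR
    have h5 : d.ϱ * (d.n - d.V1.card - d.N) ≤ 0 :=
      mul_nonpos_of_nonneg_of_nonpos hyp.typ.ϱ0.le (by linarith)
    have h6 := mul_pos hyp.δ0 hyp.typ.npos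
    have h7 := mul_pos hyp.γ0 hyp.typ.npos
    linarith

/-- The conditions on the image `u` of the vertex `t`. -/
structure Ok (d : PData V ι) (t : ℕ) (φ : ℕ → V) (u : V) : Prop where
  new : u ∉ (Finset.range t).image φ
  cnd : ∀ f, d.P t = some f → u ∈ Nb d.H (f.image φ)
  good : ∀ x A, d.Q t = some (x, A) → ∀ U ∈ d.fam φ t x,
    Good d.H d.ϱ d.γ d.n U (insert u (A.image φ))
  place : u ∈ d.V1 → (∃ x ∈ d.I1, ∃ A, d.Q t = some (x, A)) ∨
    ∃ f, d.P t = some f ∧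
      ((Nb d.H (f.image φ) ∩ (d.V1 ∪ (Finset.range t).image φ)ᶜ).card : ℝ) < d.δ * d.n
  pot : ∀ x ∈ d.I1, ∀ A, d.Q t = some (x, A) →
    ∑ v ∈ ((Finset.range t).image φ)ᶜ, (∏ x' ∈ d.I1.erase x, d.gx φ t x' v) *
        (1 - if v ∈ d.NX φ t x ∩ Nb d.H (insert u (A.image φ)) then
          d.c ^ (d.r - (d.jx t x + 1)) / 2 else 0) ≤
      ∑ v ∈ ((Finset.range t).image φ)ᶜ, (∏ x' ∈ d.I1.erase x, d.gx φ t x' v) * d.gx φ t x v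

lemma good_of_notMem (d : PData V ι) {φ : ℕ → V} {t : ℕ} {u : V}
    (h1 : u ∉ (Finset.range t).image φ) (h2 : u ∉ d.ES φ t) :
    ∀ x A, d.Q t = some (x, A) → ∀ U ∈ d.fam φ t x,
    Good d.H d.ϱ d.γ d.n U (insert u (A.image φ)) := by
  intro x A hQ U hU
  by_contra hcon
  exact h2 (Finset.mem_filter.mpr ⟨Finset.mem_univ _, h1, x, A, hQ, U, hU, hcon⟩)

lemma choose_step (d : PData V ι) (hyp : d.Hyp) {φ : ℕ → V} {t : ℕ} (ht : t < d.N)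
    (inv : d.Inv t φ) : ∃ u, d.Ok t φ u := by
  classical
  by_cases hI : ∃ x ∈ d.I1, ∃ A, d.Q t = some (x, A)
  · obtain ⟨x, hx, A, hQ⟩ := hI
    obtain ⟨u, hu, hpot⟩ := choose_avg d hyp ht inv x A hQ
      (fun v => ∏ x' ∈ d.I1.erase x, d.gx φ t x' v)
      (fun v => Finset.prod_nonneg fun x' _ => gx_nonneg d hyp φ t x' v)
    simp only [Finset.mem_sdiff, Finset.mem_inter] at hu
    obtain ⟨⟨⟨hu1, hu2⟩, hu3⟩, hu4⟩ := hu
    refine ⟨u, hu3, (Finset.mem_filter.mp hu2).2, good_of_notMem d hu3 hu4,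
      fun _ => Or.inl ⟨x, hx, A, hQ⟩, ?_⟩
    intro x' _ A' hQ'
    rw [hQ] at hQ'
    simp only [Option.some.injEq, Prod.mk.injEq] at hQ'
    obtain ⟨rfl, rfl⟩ := hQ'
    exact hpot
  · have hpot : ∀ u : V, ∀ x ∈ d.I1, ∀ A, d.Q t = some (x, A) →
    ∑ v ∈ ((Finset.range t).image φ)ᶜ, (∏ x' ∈ d.I1.erase x, d.gx φ t x' v) *
        (1 - if v ∈ d.NX φ t x ∩ Nb d.H (insert u (A.image φ)) then
          d.c ^ (d.r - (d.jx t x + 1)) / 2 else 0) ≤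
      ∑ v ∈ ((Finset.range t).image φ)ᶜ, (∏ x' ∈ d.I1.erase x, d.gx φ t x' v) * d.gx φ t x v :=
      fun u x hx A hQ => absurd ⟨x, hx, A, hQ⟩ hI
    by_cases hexc : ∃ f, d.P t = some f ∧
      ((Nb d.H (f.image φ) ∩ (d.V1 ∪ (Finset.range t).image φ)ᶜ).card : ℝ) < d.δ * d.n
    · obtain ⟨f, hf, hlt⟩ := hexc
      have h1 := cand_V1 d hyp ht inv (f.image φ) (cardP d hyp ht inv hf)
      have hcn : 0 < d.c * d.n := mul_pos hyp.c0 hyp.typ.npos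
      have h2 := h1.trans_lt' hcn
      have h3 := Finset.card_pos.mp (by exact_mod_cast h2)
      obtain ⟨u, hu⟩ := h3
      simp only [Finset.mem_sdiff, Finset.mem_inter] at hu
      obtain ⟨⟨⟨⟨hu1, hu2⟩, hu3⟩, hu4⟩, hu5⟩ := hu
      exact ⟨u, hu3, (Finset.mem_filter.mp hu2).2, good_of_notMem d hu3 hu4,
        fun _ => Or.inr ⟨f, hf, hlt⟩, hpot u⟩
    · have h1 : d.δ * d.n ≤ (d.cand φ t ∩ (d.V1 ∪ (Finset.range t).image φ)ᶜ).card := by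
        rcases hp : d.P t with _ | f
        · have : d.cand φ t = Finset.univ := by unfold cand; simp [hp]
          rw [this, Finset.univ_inter]
          have h3 := R_card d hyp φ ht.le
          have h4 := hyp.hR
          have h6 := mul_pos hyp.δ0 hyp.typ.npos
          have h7 := mul_pos hyp.γ0 hyp.typ.npos
          have h8 := hyp.typ.ϱ1
          have h9 := hyp.typ.ϱ0
          have h10 : 0 < d.n - d.V1.card - d.N := by
            by_contra hcon
            push Not at hcon
            have := mul_nonpos_of_nonneg_of_nonpos h9.le hcon
            linarith
          nlinarith
        · have : d.cand φ t = Nb d.H (f.image φ) := by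
            unfold cand; ext u; simp [hp]
          rw [this]
          by_contra hcon
          exact hexc ⟨f, hp, not_le.mp hcon⟩
      have h2 := ES_card d hyp ht inv
      have h3 := hyp.hE2
      have h4 : ((d.ES φ t).card : ℝ) <
        (d.cand φ t ∩ (d.V1 ∪ (Finset.range t).image φ)ᶜ).card := by linarith
      obtain ⟨u, hu, hu'⟩ := Finset.exists_mem_notMem_of_card_lt_card (by exact_mod_cast h4)
      rw [Finset.mem_inter, Finset.mem_compl, Finset.mem_union] at hu
      obtain ⟨hu1, hu2⟩ := hu
      push Not at hu2
      exact ⟨u, hu2.2, (Finset.mem_filter.mp hu1).2, good_of_notMem d hu2.2 hu',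
        fun h => absurd h hu2.1, hpot u⟩

lemma image_update {φ : ℕ → V} {t : ℕ} {u : V} {f : Finset ℕ} (hf : f ⊆ Finset.range t) :
    f.image (Function.update φ t u) = f.image φ := by
  apply Finset.image_congr
  intro s hs
  have := Finset.mem_range.mp (hf hs)
  exact Function.update_of_ne this.ne _ _

lemma NX_succ_ne (d : PData V ι) (hyp : d.Hyp) {φ : ℕ → V} {t : ℕ} (ht : t < d.N) (u : V) (x : ι)
    (h : ∀ A, d.Q t ≠ some (x, A)) :
    d.NX (Function.update φ t u) (t + 1) x = d.NX φ t x := by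
  unfold NX
  ext v
  simp only [Finset.mem_filter, Finset.mem_univ, true_and]
  constructor
  · intro hv s hs A hA
    have := hv s (by omega) A hA
    have hsub := (hyp.hQ s (by omega) x A hA).1
    rwa [image_update (hsub.trans (by simpa using hs.le)), Function.update_of_ne hs.ne] at this
  · intro hv s hs A hA
    have hst : s < t := by
      rcases Nat.lt_succ_iff_lt_or_eq.mp hs with h1 | h1
      · exact h1
      · subst h1; exact absurd hA (h A)
    have hsub := (hyp.hQ s (by omega) x A hA).1
    rw [image_update (hsub.trans (by simpa using hst.le)), Function.update_of_ne hst.ne]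
    exact hv s hst A hA

lemma NX_succ_eq (d : PData V ι) (hyp : d.Hyp) {φ : ℕ → V} {t : ℕ} (ht : t < d.N) (u : V) (x : ι)
    (A : Finset ℕ) (hQ : d.Q t = some (x, A)) :
    d.NX (Function.update φ t u) (t + 1) x =
      d.NX φ t x ∩ Nb d.H (insert u (A.image φ)) := by
  unfold NX
  ext v
  simp only [Finset.mem_inter, Finset.mem_filter, Finset.mem_univ, true_and]
  constructor
  · intro hv
    constructor
    · intro s hs A hA
      have := hv s (by omega) A hA
      have hsub := (hyp.hQ s (by omega) x A hA).1
      rwa [image_update (hsub.trans (by simpa using hs.le)), Function.update_of_ne hs.ne] at this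
    · have := hv t (by omega) A hQ
      have hsub := (hyp.hQ t ht x A hQ).1
      rwa [image_update hsub, Function.update_self] at this
  · rintro ⟨hv, hv'⟩ s hs A' hA
    rcases Nat.lt_succ_iff_lt_or_eq.mp hs with hst | h1
    · have hsub := (hyp.hQ s (by omega) x A' hA).1
      rw [image_update (hsub.trans (by simpa using hst.le)), Function.update_of_ne hst.ne]
      exact hv s hst A' hA
    · subst h1
      have hsub := (hyp.hQ s ht x A' hA).1
      rw [image_update hsub, Function.update_self]
      rw [hQ] at hA
      simp only [Option.some.injEq, Prod.mk.injEq] at hA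
      rw [← hA.2]; exact hv'

lemma range_image_succ {φ : ℕ → V} {t : ℕ} {u : V} :
    (Finset.range (t + 1)).image (Function.update φ t u) =
      insert u ((Finset.range t).image φ) := by
  rw [Finset.range_add_one, Finset.image_insert, Function.update_self,
    image_update (Finset.Subset.refl _)]

lemma inv_step (d : PData V ι) (hyp : d.Hyp) {φ : ℕ → V} {t : ℕ} (ht : t < d.N)
    (inv : d.Inv t φ) {u : V} (ok : d.Ok t φ u) : d.Inv (t + 1) (Function.update φ t u) := by
  classical
  have hnpos := hyp.typ.npos
  have hγn : 0 ≤ d.γ * d.n := (mul_pos hyp.γ0 hnpos).le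
  have hϱ0 := hyp.typ.ϱ0
  have hϱ1 := hyp.typ.ϱ1
  have low : ∀ (j : ℕ) (X a b : ℝ), d.ϱ ^ j * X - j * d.γ * d.n ≤ a → |b - d.ϱ * a| ≤ d.γ * d.n →
      d.ϱ ^ (j + 1) * X - (j + 1 : ℕ) * d.γ * d.n ≤ b := by
    intro j X a b h1 h2
    have h3 := (abs_le.mp h2).1
    have h4 := mul_le_mul_of_nonneg_left h1 hϱ0.le
    have h5 : d.ϱ * (j * (d.γ * d.n)) ≤ 1 * (j * (d.γ * d.n)) :=
      mul_le_mul_of_nonneg_right hϱ1 (by positivity)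
    push_cast
    rw [pow_succ]
    nlinarith
  have up : ∀ (j : ℕ) (X a b : ℝ), a ≤ d.ϱ ^ j * X + j * d.γ * d.n → |b - d.ϱ * a| ≤ d.γ * d.n →
      b ≤ d.ϱ ^ (j + 1) * X + (j + 1 : ℕ) * d.γ * d.n := by
    intro j X a b h1 h2
    have h3 := (abs_le.mp h2).2
    have h4 := mul_le_mul_of_nonneg_left h1 hϱ0.le
    have h5 : d.ϱ * (j * (d.γ * d.n)) ≤ 1 * (j * (d.γ * d.n)) :=
      mul_le_mul_of_nonneg_right hϱ1 (by positivity)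
    push_cast
    rw [pow_succ]
    nlinarith
  refine ⟨?_, ?_, ?_, ?_, ?_, ?_, ?_⟩
  · intro s hs s' hs' heq
    simp only [Finset.coe_range, Set.mem_Iio] at hs hs'
    have hnew := ok.new
    simp only [Finset.mem_image, Finset.mem_range, not_exists, not_and] at hnew
    rcases Nat.lt_succ_iff_lt_or_eq.mp hs with h | h <;>
      rcases Nat.lt_succ_iff_lt_or_eq.mp hs' with h' | h'
    · rw [Function.update_of_ne h.ne, Function.update_of_ne h'.ne] at heq
      exact inv.inj (by simpa using h) (by simpa using h') heq
    · subst h'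
      rw [Function.update_of_ne h.ne, Function.update_self] at heq
      exact absurd heq (hnew s h)
    · subst h
      rw [Function.update_of_ne h'.ne, Function.update_self] at heq
      exact absurd heq.symm (hnew s' h')
    · omega
  · intro s hs f hf
    have hsub := (hyp.hP s (by omega) f hf).1
    rcases Nat.lt_succ_iff_lt_or_eq.mp hs with h | h
    · rw [image_update (hsub.trans (by simpa using h.le)), Function.update_of_ne h.ne]
      exact inv.edge s h f hf
    · subst h
      rw [image_update hsub, Function.update_self]
      exact ok.cnd f hf
  · intro x
    by_cases h : ∃ A, d.Q t = some (x, A)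
    · obtain ⟨A, hA⟩ := h
      rw [NX_succ_eq d hyp ht u x A hA, jx_succ_eq d t x A hA]
      have hg := ok.good x A hA (d.NX φ t x) (by simp [fam])
      exact low _ _ _ _ (inv.ha x) hg
    · push Not at h
      rw [NX_succ_ne d hyp ht u x h, jx_succ_ne d t x h]
      exact inv.ha x
  · intro x x' hne hbx
    by_cases h : ∃ A, d.Q t = some (x, A)
    · obtain ⟨A, hA⟩ := h
      have h' : ∀ A', d.Q t ≠ some (x', A') := by
        intro A' hA'
        rw [hA] at hA'
        simp only [Option.some.injEq, Prod.mk.injEq] at hA'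
        exact hne hA'.1
      rw [NX_succ_eq d hyp ht u x A hA, jx_succ_eq d t x A hA, NX_succ_ne d hyp ht u x' h',
        jx_succ_ne d t x' h', Finset.inter_right_comm, Nat.add_right_comm]
      have hg := ok.good x A hA (d.NX φ t x ∩ d.NX φ t x') (by
        unfold fam
        rw [Finset.mem_insert, Finset.mem_insert]
        right; right
        exact Finset.mem_image_of_mem _ (Finset.mem_filter.mpr ⟨Finset.mem_univ _, hbx⟩))
      exact up _ _ _ _ (inv.hb x x' hne hbx) hg
    · push Not at h
      rw [NX_succ_ne d hyp ht u x h, jx_succ_ne d t x h]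
      by_cases h' : ∃ A, d.Q t = some (x', A)
      · obtain ⟨A, hA⟩ := h'
        rw [NX_succ_eq d hyp ht u x' A hA, jx_succ_eq d t x' A hA, ← Finset.inter_assoc,
          ← Nat.add_assoc]
        have hg := ok.good x' A hA (d.NX φ t x ∩ d.NX φ t x') (by
          unfold fam
          rw [Finset.mem_insert, Finset.mem_insert]
          right; right
          rw [Finset.inter_comm]
          exact Finset.mem_image_of_mem (fun z => d.NX φ t x' ∩ d.NX φ t z)
            (Finset.mem_filter.mpr ⟨Finset.mem_univ _, hbx.symm⟩))
        exact up _ _ _ _ (inv.hb x x' hne hbx) hg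
      · push Not at h'
        rw [NX_succ_ne d hyp ht u x' h', jx_succ_ne d t x' h']
        exact inv.hb x x' hne hbx
  · intro x
    by_cases h : ∃ A, d.Q t = some (x, A)
    · obtain ⟨A, hA⟩ := h
      rw [NX_succ_eq d hyp ht u x A hA, jx_succ_eq d t x A hA, Finset.inter_right_comm]
      have hg := ok.good x A hA (d.NX φ t x ∩ d.V1) (by simp [fam])
      exact low _ _ _ _ (inv.hc x) hg
    · push Not at h
      rw [NX_succ_ne d hyp ht u x h, jx_succ_ne d t x h]
      exact inv.hc x
  · refine le_trans ?_ inv.hd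
    have hsub : ((Finset.range (t + 1)).image (Function.update φ t u))ᶜ ⊆
        ((Finset.range t).image φ)ᶜ := by
      rw [range_image_succ]
      exact Finset.compl_subset_compl.mpr (Finset.subset_insert _ _)
    refine (Finset.sum_le_sum_of_subset_of_nonneg hsub
      (fun v _ _ => Finset.prod_nonneg fun x' _ => gx_nonneg d hyp _ _ x' v)).trans ?_
    by_cases hI : ∃ x ∈ d.I1, ∃ A, d.Q t = some (x, A)
    · obtain ⟨x, hx, A, hQ⟩ := hI
      have hp := ok.pot x hx A hQ
      refine le_trans (le_of_eq ?_) (hp.trans (le_of_eq ?_))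
      · apply Finset.sum_congr rfl
        intro v _
        rw [← Finset.prod_erase_mul _ _ hx]
        congr 1
        · apply Finset.prod_congr rfl
          intro x' hx'
          have h' : ∀ A', d.Q t ≠ some (x', A') := by
            intro A' hA'
            rw [hQ] at hA'
            simp only [Option.some.injEq, Prod.mk.injEq] at hA'
            exact (Finset.ne_of_mem_erase hx') hA'.1.symm
          unfold gx
          rw [NX_succ_ne d hyp ht u x' h', jx_succ_ne d t x' h']
        · unfold gx
          rw [NX_succ_eq d hyp ht u x A hQ, jx_succ_eq d t x A hQ]
      · apply Finset.sum_congr rfl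
        intro v _
        rw [Finset.prod_erase_mul _ _ hx]
    · apply le_of_eq
      apply Finset.sum_congr rfl
      intro v _
      apply Finset.prod_congr rfl
      intro x hx
      have h' : ∀ A', d.Q t ≠ some (x, A') := fun A' hA' => hI ⟨x, hx, A', hA'⟩
      unfold gx
      rw [NX_succ_ne d hyp ht u x h', jx_succ_ne d t x h']
  · intro s hs hsV
    have hsub : ((d.V1 ∪ (Finset.range (t + 1)).image (Function.update φ t u))ᶜ) ⊆
        (d.V1 ∪ (Finset.range t).image φ)ᶜ := by
      rw [range_image_succ]
      exact Finset.compl_subset_compl.mpr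
        (Finset.union_subset_union (Finset.Subset.refl _) (Finset.subset_insert _ _))
    have hmono : ∀ B : Finset V,
        ((B ∩ (d.V1 ∪ (Finset.range t).image φ)ᶜ).card : ℝ) < d.δ * d.n →
        ((B ∩ (d.V1 ∪ (Finset.range (t + 1)).image (Function.update φ t u))ᶜ).card : ℝ)
          < d.δ * d.n := by
      intro B hB
      refine lt_of_le_of_lt ?_ hB
      exact_mod_cast Finset.card_le_card (Finset.inter_subset_inter_left hsub)
    have main : (∃ x ∈ d.I1, ∃ A, d.Q s = some (x, A)) ∨
      ∃ f, d.P s = some f ∧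
      ((Nb d.H (f.image φ) ∩ (d.V1 ∪ (Finset.range t).image φ)ᶜ).card : ℝ) < d.δ * d.n := by
      rcases Nat.lt_succ_iff_lt_or_eq.mp hs with h | h
      · rw [Function.update_of_ne h.ne] at hsV
        exact inv.hg s h hsV
      · subst h
        rw [Function.update_self] at hsV
        exact ok.place hsV
    rcases main with h | ⟨f, hf, hlt⟩
    · left; exact h
    · right
      refine ⟨f, hf, ?_⟩
      have hsubf := (hyp.hP s (by omega) f hf).1
      rw [image_update (hsubf.trans (by simpa using Nat.lt_succ_iff.mp hs))]
      exact hmono _ hlt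

lemma inv_zero (d : PData V ι) (hyp : d.Hyp) (φ : ℕ → V) : d.Inv 0 φ := by
  have hj : ∀ x, d.jx 0 x = 0 := fun x => by simp [jx, JS]
  have hN : ∀ x, d.NX φ 0 x = Finset.univ := fun x => by simp [NX]
  have hn := hyp.typ.hn
  refine ⟨by simp, by simp, ?_, ?_, ?_, ?_, by simp⟩
  · intro x; rw [hj, hN, Finset.card_univ, hn]; simp
  · intro x x' _ _; rw [hj, hj, hN, hN, Finset.univ_inter, Finset.card_univ, hn]; simp
  · intro x; rw [hj, hN]; simp
  · unfold gx
    simp only [hj, hN, Finset.mem_univ, if_true, Finset.range_zero, Finset.image_empty,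
      Finset.compl_empty, Finset.prod_const, Finset.sum_const, Finset.card_univ, nsmul_eq_mul,
      Nat.sub_zero]
    rw [hn]

lemma exists_inv (d : PData V ι) (hyp : d.Hyp) (φ₀ : ℕ → V) :
    ∀ t ≤ d.N, ∃ φ, d.Inv t φ := by
  intro t
  induction t with
  | zero => exact fun _ => ⟨φ₀, inv_zero d hyp φ₀⟩
  | succ t ih =>
    intro ht
    obtain ⟨φ, hφ⟩ := ih (by omega)
    obtain ⟨u, hu⟩ := choose_step d hyp (by omega) hφ
    exact ⟨_, inv_step d hyp (by omega) hφ hu⟩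

end PData
namespace PData

variable {V ι : Type*} [Fintype V] [DecidableEq V] [Fintype ι] [DecidableEq ι]

lemma gx_final (d : PData V ι) (hyp : d.Hyp) (φ : ℕ → V) (x : ι) (u : V) :
    d.gx φ d.N x u = if u ∈ d.NX φ d.N x then 1 / 2 else 1 := by
  unfold gx
  rw [hyp.hQr x]
  split_ifs <;> norm_num

lemma count_final (d : PData V ι) (hyp : d.Hyp) {φ : ℕ → V} (inv : d.Inv d.N φ) (u : V)
    (hu : u ∈ ((Finset.range d.N).image φ)ᶜ) :
    (1 / 2 : ℝ) ^ (d.I1.filter fun x => u ∈ d.NX φ d.N x).card ≤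
      d.n * (1 - d.c ^ d.r / 2) ^ d.I1.card := by
  refine le_trans ?_ inv.hd
  refine le_trans ?_ (Finset.single_le_sum (f := fun u => ∏ x ∈ d.I1, d.gx φ d.N x u)
    (fun v _ => Finset.prod_nonneg fun x _ => d.gx_nonneg hyp φ d.N x v) hu)
  simp only [gx_final d hyp]
  rw [Finset.prod_ite]
  simp

lemma hall_finish (d : PData V ι) (hyp : d.Hyp) {φ : ℕ → V} (inv : d.Inv d.N φ)
    (hcard : Fintype.card ι + d.N = Fintype.card V) (s η γ2 : ℝ) (m0 B : ℕ)
    (hs : s * d.n ≤ d.ϱ ^ d.r * d.V1.card - d.r * d.γ * d.n -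
      (d.r * d.I1.card + d.Δ * (16 / d.γ ^ 2)))
    (hB : ∀ x, d.b x < B) (hmB : (m0 * B : ℝ) ≤ s * d.n) (hγ20 : 0 < γ2)
    (hm0 : 2 ≤ m0 * γ2 ^ 2) (hγ2 : 12 * d.r * d.γ ≤ γ2 ^ 2) (hη : γ2 ≤ d.ϱ ^ d.r * η)
    (hexp : ∀ h : ℕ, (1 / 2 : ℝ) ^ h ≤ d.n * (1 - d.c ^ d.r / 2) ^ d.I1.card → η * d.n ≤ h) :
    ∃ ψ : ι → V, Function.Injective ψ ∧ ∀ x, ψ x ∈ d.NX φ d.N x ∧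
      ψ x ∉ (Finset.range d.N).image φ := by
  classical
  have hnpos := hyp.typ.npos
  set L := ((Finset.range d.N).image φ)ᶜ with hL
  have hLc : L.card = Fintype.card ι := by
    have h1 : ((Finset.range d.N).image φ).card = d.N := by
      rw [Finset.card_image_of_injOn inv.inj, Finset.card_range]
    rw [hL, Finset.card_compl, h1]; omega
  have key : ∀ S : Finset ι, S.card ≤ (S.biUnion fun x => d.NX φ d.N x ∩ L).card := by
    intro S
    by_contra hcon
    push Not at hcon
    set U := S.biUnion fun x => d.NX φ d.N x ∩ L with hU
    have hUL : U ⊆ L := by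
      rw [hU]; apply Finset.biUnion_subset.2; intro x _; exact Finset.inter_subset_right
    have hSne : S.Nonempty := by
      rw [← Finset.card_pos]; omega
    by_cases hsmall : (S.card : ℝ) ≤ s * d.n
    · obtain ⟨x, hx⟩ := hSne
      have h1 : (d.NX φ d.N x ∩ L).card ≤ U.card :=
        Finset.card_le_card (Finset.subset_biUnion_of_mem (fun x => d.NX φ d.N x ∩ L) hx)
      have h2 := inv.hc x
      rw [hyp.hQr x] at h2
      have h3 := d.usedV1 hyp le_rfl inv
      have h4 : (d.NX φ d.N x ∩ d.V1).card ≤ (d.NX φ d.N x ∩ L).card +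
          (d.V1 ∩ (Finset.range d.N).image φ).card := by
        refine le_trans (Finset.card_le_card ?_) (Finset.card_union_le _ _)
        intro v hv
        rw [Finset.mem_inter] at hv
        by_cases hv' : v ∈ (Finset.range d.N).image φ
        · exact Finset.mem_union_right _ (Finset.mem_inter.2 ⟨hv.2, hv'⟩)
        · exact Finset.mem_union_left _ (Finset.mem_inter.2 ⟨hv.1, by
            rw [hL, Finset.mem_compl]; exact hv'⟩)
      have h4' : ((d.NX φ d.N x ∩ d.V1).card : ℝ) ≤ (d.NX φ d.N x ∩ L).card +
          (d.V1 ∩ (Finset.range d.N).image φ).card := by exact_mod_cast h4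
      have h1' : ((d.NX φ d.N x ∩ L).card : ℝ) ≤ U.card := by exact_mod_cast h1
      have h5 : (U.card : ℝ) < S.card := by exact_mod_cast hcon
      linarith
    · push Not at hsmall
      set Z := L \ U with hZ
      have hZc : Z.card + U.card = L.card := Finset.card_sdiff_add_card_eq_card hUL
      have hScard : S.card ≤ Fintype.card ι := Finset.card_le_univ S
      have hdis : ∀ x ∈ S, ∀ v ∈ Z, v ∉ d.NX φ d.N x := by
        intro x hx v hv hvx
        rw [hZ, Finset.mem_sdiff] at hv
        apply hv.2
        rw [hU, Finset.mem_biUnion]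
        exact ⟨x, hx, Finset.mem_inter.2 ⟨hvx, hv.1⟩⟩
      by_cases hZbig : η * d.n ≤ Z.card
      · have hpig : (Finset.range B).card * m0 < S.card := by
          rw [Finset.card_range]
          have : (m0 * B : ℝ) < S.card := lt_of_le_of_lt hmB hsmall
          have h2 : m0 * B < S.card := by exact_mod_cast this
          rw [mul_comm]; exact h2
        obtain ⟨y, hy, hyc⟩ := Finset.exists_lt_card_fiber_of_mul_lt_card_of_maps_to
          (s := S) (t := Finset.range B) (f := d.b) (n := m0)
          (fun x _ => Finset.mem_range.2 (hB x)) hpig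
        have hϱ0 := hyp.typ.ϱ0
        have hϱ1 := hyp.typ.ϱ1
        have hγ0 := hyp.γ0
        have hsm := second_moment (S.filter fun x => d.b x = y) (fun x => d.NX φ d.N x) Z
          (d.ϱ ^ d.r) (2 * d.r * d.γ) γ2 d.n (by positivity) (pow_le_one₀ hϱ0.le hϱ1)
          (by positivity) (by linarith) hγ20 hyp.typ.hn hnpos
          (by
            intro x _
            have := inv.ha x
            rw [hyp.hQr x] at this
            have h0 : 0 ≤ d.r * d.γ * d.n := by positivity
            linarith)
          (by
            intro x hx x' hx' hne
            rw [Finset.mem_filter] at hx hx'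
            have := inv.hb x x' hne (by rw [hx.2, hx'.2])
            rw [hyp.hQr x, hyp.hQr x'] at this
            refine this.trans (le_of_eq ?_)
            push_cast
            ring)
          (by
            intro x hx
            rw [Finset.mem_filter] at hx
            have : d.NX φ d.N x ∩ Z = ∅ := by
              rw [← Finset.disjoint_iff_inter_eq_empty, Finset.disjoint_right]
              exact hdis x hx.1
            rw [this]
            simp only [Finset.card_empty, Nat.cast_zero]
            have h1 : d.ϱ ^ d.r * (η * d.n) ≤ d.ϱ ^ d.r * Z.card :=
              mul_le_mul_of_nonneg_left hZbig (by positivity)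
            have h2 : γ2 * d.n ≤ d.ϱ ^ d.r * η * d.n :=
              mul_le_mul_of_nonneg_right hη hnpos.le
            linarith)
        have h6 : (m0 : ℝ) < (S.filter fun x => d.b x = y).card := by exact_mod_cast hyc
        have h7 : (m0 : ℝ) * γ2 ^ 2 < (S.filter fun x => d.b x = y).card * γ2 ^ 2 :=
          mul_lt_mul_of_pos_right h6 (by positivity)
        linarith
      · push Not at hZbig
        have hZne : Z.Nonempty := by
          rw [← Finset.card_pos]; omega
        obtain ⟨u, hu⟩ := hZne
        have huL : u ∈ L := (Finset.mem_sdiff.1 hu).1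
        have h1 := hexp _ (d.count_final hyp inv u huL)
        have h2 : (d.I1.filter fun x => u ∈ d.NX φ d.N x) ⊆ Sᶜ := by
          intro x hx
          rw [Finset.mem_filter] at hx
          rw [Finset.mem_compl]
          intro hxS
          exact hdis x hxS u hu hx.2
        have h3 := Finset.card_le_card h2
        rw [Finset.card_compl] at h3
        have h4 : (d.I1.filter fun x => u ∈ d.NX φ d.N x).card ≤ Z.card := by omega
        have h5 : ((d.I1.filter fun x => u ∈ d.NX φ d.N x).card : ℝ) ≤ Z.card := by
          exact_mod_cast h4
        linarith
  obtain ⟨ψ, h1, h2⟩ := (Finset.all_card_le_biUnion_card_iff_exists_injective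
    (fun x => d.NX φ d.N x ∩ L)).1 key
  refine ⟨ψ, h1, fun x => ⟨(Finset.mem_inter.1 (h2 x)).1, ?_⟩⟩
  have := (Finset.mem_inter.1 (h2 x)).2
  rwa [hL, Finset.mem_compl] at this

end PData

lemma exists_V1 (K : ℕ) (ϱ μ : ℝ) (hϱ : 0 < ϱ) (hϱ1 : ϱ ≤ 1) (hμ : 0 < μ) :
    ∃ c1 : ℝ, 0 < c1 ∧ ∀ᶠ n : ℕ in Filter.atTop, ∀ (H : Finset (Finset (Fin n))) (ε : ℝ),
      ε ≤ ϱ ^ 2 / 2 → Typ H K ϱ ε n → ∃ V1 : Finset (Fin n), (V1.card : ℝ) ≤ μ * n ∧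
      ∀ f f' : Finset (Fin n), f.card = K → f'.card = K →
        c1 * n ≤ (V1 ∩ (Nb H f ∩ Nb H f')).card := by
  classical
  set a : ℝ := ϱ ^ 2 / 2 with ha
  set θ : ℝ := min μ (a / 2) with hθ
  have ha0 : 0 < a := by positivity
  have ha1 : a ≤ 1 := by rw [ha]; nlinarith
  have hθ0 : 0 < θ := lt_min hμ (by positivity)
  have hθμ : θ ≤ μ := min_le_left _ _
  have hθa : θ ≤ a / 2 := min_le_right _ _
  refine ⟨a / 4 * (θ / 2) / 2, by positivity, ?_⟩
  filter_upwards [exp_count (a / 4) (θ / 2) (by positivity) (by positivity) (2 * K),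
    Filter.eventually_ge_atTop ⌈2 / θ⌉₊] with n hexp hn H ε hε hT
  have hnpos := hT.npos
  have hn2 : 2 / θ ≤ (n : ℝ) := Nat.ceil_le.1 hn
  rw [div_le_iff₀ hθ0] at hn2
  have hθn : 0 ≤ θ * n := by positivity
  have hfl := Nat.floor_le hθn
  have hfl2 := Nat.lt_floor_add_one (θ * n)
  set m := ⌊θ * n⌋₊ with hm
  have hθan : θ * n ≤ a / 2 * n := mul_le_mul_of_nonneg_right hθa hnpos.le
  have hW : ∀ f f' : Finset (Fin n), f.card = K → f'.card = K →
      a * n ≤ ((Nb H f ∩ Nb H f').card : ℝ) := by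
    intro f f' hf hf'
    have hεn : ε * n ≤ ϱ ^ 2 / 2 * n := mul_le_mul_of_nonneg_right hε hnpos.le
    by_cases hff : f = f'
    · subst hff
      have h1 := (abs_le.1 (hT.one f hf)).1
      rw [Finset.inter_self]
      have h2 : ϱ ^ 2 * n ≤ ϱ * n := mul_le_mul_of_nonneg_right (by nlinarith) hnpos.le
      rw [ha]; linarith
    · have h1 := (abs_le.1 (hT.two f f' hf hf' hff)).1
      rw [ha]; linarith
  obtain ⟨V1, hc, hsum⟩ := hitting_set
    (Finset.powersetCard K (Finset.univ : Finset (Fin n)) ×ˢ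
      Finset.powersetCard K (Finset.univ : Finset (Fin n)))
    (fun x => Nb H x.1 ∩ Nb H x.2) a n ha0 hT.hn
    (by
      rintro ⟨f, f'⟩ hx
      simp only [Finset.mem_product, Finset.mem_powersetCard_univ] at hx
      exact hW f f' hx.1 hx.2) m (by linarith)
    (by
      have h1 : (m : ℝ) ≤ n := by nlinarith
      rw [Fintype.card_fin]; exact_mod_cast h1)
  refine ⟨V1, ?_, ?_⟩
  · rw [hc]
    have : θ * n ≤ μ * n := mul_le_mul_of_nonneg_right hθμ hnpos.le
    linarith
  · intro f f' hf hf'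
    have hmn : θ / 2 * n ≤ (m : ℝ) := by linarith
    refine hexp _ m hmn (by linarith) ?_
    refine le_trans (Finset.single_le_sum
      (f := fun x : Finset (Fin n) × Finset (Fin n) =>
        (1 / 2 : ℝ) ^ (V1 ∩ (Nb H x.1 ∩ Nb H x.2)).card) (fun x _ => by positivity)
      (a := (f, f')) (by simp [hf, hf'])) (hsum.trans ?_)
    apply mul_le_mul_of_nonneg_right _ (pow_nonneg (by linarith) _)
    rw [Finset.card_product, Finset.card_powersetCard, Finset.card_univ, Fintype.card_fin]
    have h1 : n.choose K ≤ n ^ K := Nat.choose_le_pow n K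
    have h2 : n.choose K * n.choose K ≤ n ^ (2 * K) := by
      rw [two_mul, pow_add]; exact Nat.mul_le_mul h1 h1
    exact_mod_cast h2
lemma tree_rank {n k : ℕ} (hk : 1 ≤ k) (T : Finset (Finset (Fin n))) (hT : IsTightTree k T) :
    (∀ e ∈ T, e.card = k) ∧ ∃ rk : Fin n → ℕ, Function.Injective rk ∧
      ∀ e ∈ T, ∀ e' ∈ T, ∀ v, v ∈ e → v ∈ e' → (∀ w ∈ e, rk w ≤ rk v) →
        (∀ w ∈ e', rk w ≤ rk v) → e = e' := by
  obtain ⟨es, hne, hnd, rfl, hc, hv⟩ := hT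
  refine ⟨fun e he => hc e (by simpa using he), ?_⟩
  set idx : Fin n → ℕ := fun v => sInf {i | v ∈ es.getD i ∅} with hidx
  have hle : ∀ i v, v ∈ es.getD i ∅ → idx v ≤ i := fun i v h => Nat.sInf_le h
  have hex : ∀ i < es.length, ∃ w ∈ es.getD i ∅, idx w = i := by
    intro i hi
    rcases Nat.eq_zero_or_pos i with rfl | hpos
    · have hmem : es.getD 0 ∅ ∈ es := by
        rw [List.getD_eq_getElem _ _ hi]; exact List.getElem_mem hi
      have h1 := hc _ hmem
      obtain ⟨w, hw⟩ := Finset.card_pos.1 (show 0 < (es.getD 0 ∅).card by omega)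
      exact ⟨w, hw, Nat.le_zero.1 (hle 0 w hw)⟩
    · obtain ⟨v, hvm, hvn, -⟩ := hv i hpos hi
      refine ⟨v, hvm, le_antisymm (hle i v hvm) ?_⟩
      by_contra hlt
      push Not at hlt
      have : idx v ∈ {i | v ∈ es.getD i ∅} := Nat.sInf_mem ⟨i, hvm⟩
      exact hvn _ hlt this
  have hlex : ∀ v w : Fin n, idx w * n + w ≤ idx v * n + v → idx w ≤ idx v := by
    intro v w h
    by_contra hlt
    push Not at hlt
    have h1 : (idx v + 1) * n ≤ idx w * n := Nat.mul_le_mul_right _ hlt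
    have h2 := v.2
    rw [add_mul] at h1
    omega
  refine ⟨fun v => idx v * n + v, ?_, ?_⟩
  · intro v w h
    have h : idx v * n + v = idx w * n + w := h
    have h1 := hlex v w h.ge
    have h2 := hlex w v h.le
    have h3 : idx v = idx w := le_antisymm h2 h1
    rw [h3] at h
    exact Fin.ext (by omega)
  · intro e he e' he' v hve hve' h1 h2
    have main : ∀ e ∈ es.toFinset, v ∈ e → (∀ w ∈ e, idx w * n + w ≤ idx v * n + v) →
        e = es.getD (idx v) ∅ := by
      intro e he hve h1
      rw [List.mem_toFinset] at he
      obtain ⟨i, hi, rfl⟩ := List.mem_iff_getElem.1 he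
      have hg : es.getD i ∅ = es[i] := List.getD_eq_getElem _ _ hi
      obtain ⟨w, hw, hwi⟩ := hex i hi
      rw [hg] at hw
      have h3 := hlex _ _ (h1 w hw)
      have h4 := hle i v (by rw [hg]; exact hve)
      have h5 : idx v = i := by omega
      rw [h5, hg]
    rw [main e he hve h1, main e' he' hve' h2]

lemma option_of_rel {β : Type*} (R : ℕ → β → Prop) (hR : ∀ t f f', R t f → R t f' → f = f') :
    ∃ P : ℕ → Option β, ∀ t f, P t = some f ↔ R t f := by
  refine ⟨fun t => if h : ∃ f, R t f then some h.choose else none, ?_⟩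
  intro t f
  by_cases h : ∃ f, R t f
  · simp only [dif_pos h, Option.some.injEq]
    constructor
    · rintro rfl; exact h.choose_spec
    · intro hf; exact hR t _ _ h.choose_spec hf
  · simp only [dif_neg h]
    constructor
    · intro h'; cases h'
    · intro hf; exact absurd ⟨f, hf⟩ h

lemma tree_seq {n k Δ r : ℕ} (hk : 2 ≤ k) (T : Finset (Finset (Fin n)))
    (hTk : ∀ e ∈ T, e.card = k) (hΔ : ∀ v, vdeg T v ≤ Δ) (rk : Fin n → ℕ)
    (hrk : Function.Injective rk)
    (hmax : ∀ e ∈ T, ∀ e' ∈ T, ∀ v, v ∈ e → v ∈ e' → (∀ w ∈ e, rk w ≤ rk v) →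
        (∀ w ∈ e', rk w ≤ rk v) → e = e')
    (I : Finset (Fin n)) (hIr : ∀ x ∈ I, vdeg T x = r)
    (hI : ∀ x ∈ I, ∀ x' ∈ I, ∀ y, ∀ e ∈ T, ∀ e' ∈ T, x ∈ e → y ∈ e → x' ∈ e' → y ∈ e' → x = x') :
    ∃ (τ : Fin n → ℕ) (P : ℕ → Option (Finset ℕ)) (Q : ℕ → Option (I × Finset ℕ)),
      (∀ y ∉ I, τ y < Iᶜ.card) ∧ (∀ y ∉ I, ∀ z ∉ I, τ y = τ z → y = z) ∧
      (∀ t f, P t = some f → f ⊆ Finset.range t ∧ f.card = k - 1) ∧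
      (∀ t x A, Q t = some (x, A) → A ⊆ Finset.range t ∧ A.card + 1 = k - 1) ∧
      (∀ f, ((Finset.range Iᶜ.card).filter fun t => P t = some f).card ≤ Δ) ∧
      (∀ x, ((Finset.range Iᶜ.card).filter fun t => ∃ A, Q t = some (x, A)).card = r) ∧
      (∀ e ∈ T, (∀ x ∈ I, x ∉ e) → ∃ t < Iᶜ.card, ∃ f, P t = some f ∧ e.image τ = insert t f) ∧
      (∀ e ∈ T, ∀ x : I, x.1 ∈ e → ∃ t < Iᶜ.card, ∃ A, Q t = some (x, A) ∧
        (e.erase x.1).image τ = insert t A) := by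
  classical
  set τ : Fin n → ℕ := fun y => (Iᶜ.filter fun z => rk z < rk y).card with hτ
  have hτN : ∀ y ∉ I, τ y < Iᶜ.card := by
    intro y hy
    apply Finset.card_lt_card
    rw [Finset.ssubset_iff_of_subset (Finset.filter_subset _ _)]
    exact ⟨y, Finset.mem_compl.2 hy, by simp⟩
  have hτlt : ∀ y ∉ I, ∀ z, rk y < rk z → τ y < τ z := by
    intro y hy z hyz
    apply Finset.card_lt_card
    rw [Finset.ssubset_iff_of_subset]
    · exact ⟨y, by simp [hy, hyz], by simp⟩
    · intro w hw
      rw [Finset.mem_filter] at hw ⊢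
      exact ⟨hw.1, hw.2.trans hyz⟩
  have hτinj : ∀ y ∉ I, ∀ z ∉ I, τ y = τ z → y = z := by
    intro y hy z hz h
    by_contra hne
    rcases lt_or_gt_of_ne (fun h' => hne (hrk h')) with h' | h'
    · exact absurd h (hτlt y hy z h').ne
    · exact absurd h (hτlt z hz y h').ne'
  have hlt : ∀ e : Finset (Fin n), (∀ x ∈ I, x ∉ e) → ∀ y, (∀ w ∈ e, rk w ≤ rk y) → 
      (e.erase y).image τ ⊆ Finset.range (τ y) := by
    intro e he y hy j hj
    rw [Finset.mem_image] at hj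
    obtain ⟨w, hw, rfl⟩ := hj
    rw [Finset.mem_erase] at hw
    rw [Finset.mem_range]
    exact hτlt w (fun h => he w h hw.2) y (lt_of_le_of_ne (hy w hw.2) (fun h => hw.1 (hrk h)))
  have hci : ∀ e : Finset (Fin n), (∀ x ∈ I, x ∉ e) → (e.image τ).card = e.card := by
    intro e he
    apply Finset.card_image_of_injOn
    intro y hy z hz h
    exact hτinj y (fun h => he y h hy) z (fun h => he z h hz) h
  have hexmax : ∀ e : Finset (Fin n), 0 < e.card → ∃ y ∈ e, ∀ w ∈ e, rk w ≤ rk y := by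
    intro e he
    exact Finset.exists_max_image e rk (Finset.card_pos.1 he)
  have hone : ∀ e ∈ T, ∀ x ∈ I, x ∈ e → ∀ x' ∈ I, x' ∉ e.erase x := by
    intro e he x hx hxe x' hx' h
    rw [Finset.mem_erase] at h
    exact h.1 (hI x' hx' x hx x e he e he h.2 hxe hxe hxe)
  let PE : ℕ → Finset ℕ → Finset (Fin n) → Fin n → Prop := fun t f e y =>
    e ∈ T ∧ (∀ x ∈ I, x ∉ e) ∧ y ∈ e ∧ (∀ w ∈ e, rk w ≤ rk y) ∧ τ y = t ∧
      f = (e.erase y).image τ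
  let QE : ℕ → I × Finset ℕ → Finset (Fin n) → Fin n → Prop := fun t p e y =>
    e ∈ T ∧ p.1.1 ∈ e ∧ y ∈ e.erase p.1.1 ∧ (∀ w ∈ e.erase p.1.1, rk w ≤ rk y) ∧ τ y = t ∧
      p.2 = ((e.erase p.1.1).erase y).image τ
  have PEu : ∀ t f f' e e' y y', PE t f e y → PE t f' e' y' → e = e' ∧ y = y' := by
    rintro t f f' e e' y y' ⟨h1, h2, h3, h4, h5, -⟩ ⟨h1', h2', h3', h4', h5', -⟩
    have hy : y = y' := hτinj y (fun h => h2 y h h3) y' (fun h => h2' y' h h3') (h5.trans h5'.symm)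
    subst hy
    exact ⟨hmax e h1 e' h1' y h3 h3' h4 h4', rfl⟩
  have QEu : ∀ t p p' e e' y y', QE t p e y → QE t p' e' y' → e = e' ∧ y = y' ∧ p.1 = p'.1 := by
    rintro t ⟨⟨x, hx⟩, A⟩ ⟨⟨x', hx'⟩, A'⟩ e e' y y' ⟨h1, h2, h3, h4, h5, -⟩
      ⟨h1', h2', h3', h4', h5', -⟩
    simp only at h2 h2' h3 h3' h4 h4'
    have hyI : y ∉ I := fun h => hone e h1 x hx h2 y h h3
    have hyI' : y' ∉ I := fun h => hone e' h1' x' hx' h2' y' h h3'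
    have hy : y = y' := hτinj y hyI y' hyI' (h5.trans h5'.symm)
    subst hy
    have hye := Finset.mem_of_mem_erase h3
    have hye' := Finset.mem_of_mem_erase h3'
    have hxx : x = x' := hI x hx x' hx' y e h1 e' h1' h2 hye h2' hye'
    subst hxx
    have hyx : y ≠ x := Finset.ne_of_mem_erase h3
    refine ⟨?_, rfl, rfl⟩
    rcases le_total (rk x) (rk y) with hle | hle
    · refine hmax e h1 e' h1' y hye hye' ?_ ?_
      · intro w hw
        by_cases hwx : w = x
        · rw [hwx]; exact hle
        · exact h4 w (Finset.mem_erase.2 ⟨hwx, hw⟩)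
      · intro w hw
        by_cases hwx : w = x
        · rw [hwx]; exact hle
        · exact h4' w (Finset.mem_erase.2 ⟨hwx, hw⟩)
    · refine hmax e h1 e' h1' x h2 h2' ?_ ?_
      · intro w hw
        by_cases hwx : w = x
        · rw [hwx]
        · exact (h4 w (Finset.mem_erase.2 ⟨hwx, hw⟩)).trans hle
      · intro w hw
        by_cases hwx : w = x
        · rw [hwx]
        · exact (h4' w (Finset.mem_erase.2 ⟨hwx, hw⟩)).trans hle
  obtain ⟨P, hP⟩ := option_of_rel (fun t f => ∃ e y, PE t f e y) (by
    rintro t f f' ⟨e, y, h⟩ ⟨e', y', h'⟩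
    obtain ⟨rfl, rfl⟩ := PEu t f f' e e' y y' h h'
    rw [h.2.2.2.2.2, h'.2.2.2.2.2])
  obtain ⟨Q, hQ⟩ := option_of_rel (fun t p => ∃ e y, QE t p e y) (by
    rintro t p p' ⟨e, y, h⟩ ⟨e', y', h'⟩
    obtain ⟨rfl, rfl, h3⟩ := QEu t p p' e e' y y' h h'
    refine Prod.ext h3 ?_
    rw [h.2.2.2.2.2, h'.2.2.2.2.2, h3])
  refine ⟨τ, P, Q, hτN, hτinj, ?_, ?_, ?_, ?_, ?_, ?_⟩
  · intro t f hf
    obtain ⟨e, y, h1, h2, h3, h4, h5, h6⟩ := (hP t f).1 hf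
    rw [h6, ← h5]
    refine ⟨hlt e h2 y h4, ?_⟩
    rw [hci _ (fun x hx h => h2 x hx (Finset.mem_of_mem_erase h)), Finset.card_erase_of_mem h3,
      hTk e h1]
  · intro t x A hA
    obtain ⟨e, y, h1, h2, h3, h4, h5, h6⟩ := (hQ t (x, A)).1 hA
    simp only at h2 h3 h4 h6
    have h7 := hone e h1 x.1 x.2 h2
    rw [h6, ← h5]
    refine ⟨hlt _ h7 y h4, ?_⟩
    rw [hci _ (fun x hx h => h7 x hx (Finset.mem_of_mem_erase h)), Finset.card_erase_of_mem h3,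
      Finset.card_erase_of_mem h2, hTk e h1]
    omega
  · intro f
    rcases Finset.eq_empty_or_nonempty
      ((Finset.range Iᶜ.card).filter fun t => P t = some f) with h0 | ⟨t0, ht0⟩
    · rw [h0]; simp
    · rw [Finset.mem_filter] at ht0
      obtain ⟨e0, y0, h1, h2, h3, h4, h5, h6⟩ := (hP t0 f).1 ht0.2
      have hc : 0 < (e0.erase y0).card := by
        rw [Finset.card_erase_of_mem h3, hTk e0 h1]; omega
      obtain ⟨w, hw⟩ := Finset.card_pos.1 hc
      have hwf : τ w ∈ f := by rw [h6]; exact Finset.mem_image_of_mem _ hw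
      have hwI : w ∉ I := fun h => h2 w h (Finset.mem_of_mem_erase hw)
      refine le_trans ?_ (hΔ w)
      choose e y hey using fun t (ht : P t = some f) => (hP t f).1 ht
      refine Finset.card_le_card_of_injOn (fun t => if h : P t = some f then e t h else ∅) ?_ ?_
      · intro t ht
        have ht' : P t = some f := (Finset.mem_filter.1 ht).2
        simp only [dif_pos ht', Finset.coe_filter, Set.mem_ofPred_eq]
        obtain ⟨g1, g2, g3, g4, g5, g6⟩ := hey t ht'
        refine ⟨g1, ?_⟩
        rw [g6, Finset.mem_image] at hwf
        obtain ⟨w', hw', hww⟩ := hwf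
        have hw'e := Finset.mem_of_mem_erase hw'
        have : w' = w := hτinj w' (fun h => g2 w' h hw'e) w hwI hww
        rwa [← this]
      · intro t ht t' ht' heq
        have h' : P t = some f := (Finset.mem_filter.1 ht).2
        have h'' : P t' = some f := (Finset.mem_filter.1 ht').2
        simp only [dif_pos h', dif_pos h''] at heq
        obtain ⟨g1, g2, g3, g4, g5, g6⟩ := hey t h'
        obtain ⟨k1, k2, k3, k4, k5, k6⟩ := hey t' h''
        rw [← g5, ← k5]
        rw [← heq] at k3 k4
        rw [hrk (le_antisymm (k4 _ g3) (g4 _ k3))]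
  · intro x
    rw [← hIr x.1 x.2]
    symm
    have hex2 : ∀ e, e ∈ T ∧ x.1 ∈ e → ∃ y ∈ e.erase x.1, ∀ w ∈ e.erase x.1, rk w ≤ rk y := by
      rintro e ⟨he, hxe⟩
      apply hexmax
      rw [Finset.card_erase_of_mem hxe, hTk e he]; omega
    choose y hy1 hy2 using hex2
    refine Finset.card_bij (fun e he => τ (y e (Finset.mem_filter.1 he))) ?_ ?_ ?_
    · intro e he
      have he' := Finset.mem_filter.1 he
      rw [Finset.mem_filter, Finset.mem_range]
      refine ⟨hτN _ fun h => hone e he'.1 x.1 x.2 he'.2 _ h (hy1 e he'),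
        ((e.erase x.1).erase (y e he')).image τ, (hQ _ (x, _)).2 ⟨e, y e he', he'.1, he'.2, hy1 e he', hy2 e he', rfl, rfl⟩⟩
    · intro e he e' he' heq
      have he1 := Finset.mem_filter.1 he
      have he1' := Finset.mem_filter.1 he'
      exact (QEu (τ (y e he1)) (x, ((e.erase x.1).erase (y e he1)).image τ)
        (x, ((e'.erase x.1).erase (y e' he1')).image τ) e e' (y e he1) (y e' he1')
        ⟨he1.1, he1.2, hy1 e he1, hy2 e he1, rfl, rfl⟩
        ⟨he1'.1, he1'.2, hy1 e' he1', hy2 e' he1', heq.symm, rfl⟩).1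
    · intro t ht
      rw [Finset.mem_filter] at ht
      obtain ⟨-, A, hA⟩ := ht
      obtain ⟨e, z, h1, h2, h3, h4, h5, h6⟩ := (hQ t (x, A)).1 hA
      have he : e ∈ T ∧ x.1 ∈ e := ⟨h1, h2⟩
      refine ⟨e, Finset.mem_filter.2 he, ?_⟩
      rw [← h5, hrk (le_antisymm (hy2 e he z h3) (h4 _ (hy1 e he)))]
  · intro e he hIe
    obtain ⟨y, hy, hym⟩ := hexmax e (by rw [hTk e he]; omega)
    refine ⟨τ y, hτN y fun h => hIe y h hy, _, (hP _ _).2 ⟨e, y, he, hIe, hy, hym, rfl, rfl⟩, ?_⟩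
    rw [← Finset.image_insert, Finset.insert_erase hy]
  · intro e he x hxe
    obtain ⟨y, hy, hym⟩ := hexmax (e.erase x.1) (by
      rw [Finset.card_erase_of_mem hxe, hTk e he]; omega)
    refine ⟨τ y, hτN y fun h => hone e he x.1 x.2 hxe y h hy,
      ((e.erase x.1).erase y).image τ, (hQ _ (x, _)).2 ⟨e, y, he, hxe, hy, hym, rfl, rfl⟩, ?_⟩
    rw [← Finset.image_insert, Finset.insert_erase hy]

lemma exists_indep {n k Δ : ℕ} (T : Finset (Finset (Fin n)))
    (hTk : ∀ e ∈ T, e.card = k) (hΔ : ∀ v, vdeg T v ≤ Δ) :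
    ∃ r ≤ Δ, ∃ I : Finset (Fin n), (∀ x ∈ I, vdeg T x = r) ∧
      (∀ x ∈ I, ∀ x' ∈ I, ∀ y, ∀ e ∈ T, ∀ e' ∈ T, x ∈ e → y ∈ e → x' ∈ e' → y ∈ e' → x = x') ∧
      n ≤ (Δ + 1) * (I.card * (Δ * (k * (Δ * k)) + 1)) := by
  classical
  obtain ⟨r, hr, hrc⟩ : ∃ r ∈ Finset.range (Δ + 1), n ≤ (Δ + 1) *
      ((Finset.univ : Finset (Fin n)).filter fun v => vdeg T v = r).card := by
    by_contra hcon
    push Not at hcon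
    have h1 := Finset.card_eq_sum_card_fiberwise (s := (Finset.univ : Finset (Fin n)))
      (t := Finset.range (Δ + 1)) (f := vdeg T)
      (fun v _ => by simpa using Nat.lt_succ_of_le (hΔ v))
    rw [Finset.card_univ, Fintype.card_fin] at h1
    have h2 : ∑ b ∈ Finset.range (Δ + 1), (Δ + 1) *
        ((Finset.univ : Finset (Fin n)).filter fun v => vdeg T v = b).card <
        ∑ b ∈ Finset.range (Δ + 1), n := Finset.sum_lt_sum_of_nonempty ⟨0, by simp⟩ hcon
    rw [← Finset.mul_sum, ← h1] at h2
    simp at h2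
  refine ⟨r, Nat.lt_succ_iff.1 (Finset.mem_range.1 hr), ?_⟩
  set J := (Finset.univ : Finset (Fin n)).filter fun v => vdeg T v = r with hJ
  let ind : Finset (Fin n) → Prop := fun I =>
    ∀ x ∈ I, ∀ x' ∈ I, ∀ y, ∀ e ∈ T, ∀ e' ∈ T, x ∈ e → y ∈ e → x' ∈ e' → y ∈ e' → x = x'
  obtain ⟨I, hI, hImax⟩ := Finset.exists_max_image (J.powerset.filter ind) Finset.card
    ⟨∅, by simp [ind]⟩
  rw [Finset.mem_filter, Finset.mem_powerset] at hI
  refine ⟨I, fun x hx => (Finset.mem_filter.1 (hI.1 hx)).2, hI.2, ?_⟩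
  let C : Fin n → Finset (Fin n) := fun x => insert x ((T.filter fun e => x ∈ e).biUnion fun e =>
    e.biUnion fun y => (T.filter fun e => y ∈ e).biUnion id)
  have hCc : ∀ x, (C x).card ≤ Δ * (k * (Δ * k)) + 1 := by
    intro x
    refine (Finset.card_insert_le _ _).trans (Nat.succ_le_succ ?_)
    refine (Finset.card_biUnion_le_card_mul _ _ (k * (Δ * k)) ?_).trans
      (Nat.mul_le_mul_right _ (hΔ x))
    intro e he
    have hek := hTk e (Finset.mem_filter.1 he).1
    refine (Finset.card_biUnion_le_card_mul _ _ (Δ * k) ?_).trans (by rw [hek])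
    intro y _
    refine (Finset.card_biUnion_le_card_mul _ _ k ?_).trans (Nat.mul_le_mul_right _ (hΔ y))
    intro e' he'
    exact (hTk e' (Finset.mem_filter.1 he').1).le
  have hcov : J ⊆ I.biUnion C := by
    intro x hx
    by_contra hno
    have hxI : x ∉ I := fun h => hno (Finset.mem_biUnion.2 ⟨x, h, Finset.mem_insert_self _ _⟩)
    have hnc : ∀ x' ∈ I, ∀ y, ∀ e ∈ T, ∀ e' ∈ T, x ∈ e → y ∈ e → x' ∈ e' → y ∈ e' → False := by
      intro x' hx' y e he e' he' h1 h2 h3 h4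
      apply hno
      refine Finset.mem_biUnion.2 ⟨x', hx', Finset.mem_insert_of_mem ?_⟩
      refine Finset.mem_biUnion.2 ⟨e', Finset.mem_filter.2 ⟨he', h3⟩, ?_⟩
      refine Finset.mem_biUnion.2 ⟨y, h4, ?_⟩
      exact Finset.mem_biUnion.2 ⟨e, Finset.mem_filter.2 ⟨he, h2⟩, h1⟩
    have := hImax (insert x I) (by
      rw [Finset.mem_filter, Finset.mem_powerset]
      refine ⟨Finset.insert_subset hx hI.1, ?_⟩
      intro a ha b hb y e he e' he' h1 h2 h3 h4
      rcases Finset.mem_insert.1 ha with ha2 | ha2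
      · subst ha2
        rcases Finset.mem_insert.1 hb with hb2 | hb2
        · exact hb2.symm
        · exact (hnc b hb2 y e he e' he' h1 h2 h3 h4).elim
      · rcases Finset.mem_insert.1 hb with hb2 | hb2
        · subst hb2
          exact (hnc a ha2 y e' he' e he h3 h4 h1 h2).elim
        · exact hI.2 a ha2 b hb2 y e he e' he' h1 h2 h3 h4)
    rw [Finset.card_insert_of_notMem hxI] at this
    omega
  have h5 : J.card ≤ I.card * (Δ * (k * (Δ * k)) + 1) :=
    (Finset.card_le_card hcov).trans (Finset.card_biUnion_le_card_mul _ _ _ fun x _ => hCc x)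
  exact hrc.trans (Nat.mul_le_mul_left _ h5)
lemma ev_lin (A b : ℝ) (hb : 0 < b) : ∀ᶠ n : ℕ in Filter.atTop, A ≤ b * n := by
  filter_upwards [Filter.eventually_ge_atTop ⌈A / b⌉₊] with n hn
  have h : A / b ≤ (n : ℝ) := Nat.ceil_le.1 hn
  rw [div_le_iff₀ hb] at h
  linarith

lemma card_block {ι : Type*} [Fintype ι] [DecidableEq ι] (M : ℕ) (hM : 0 < M) :
    ∃ b : ι → ℕ, (∀ x, (Finset.univ.filter fun x' => b x' = b x).card ≤ M) ∧
      ∀ x, b x < Fintype.card ι / M + 1 := by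
  refine ⟨fun x => (Fintype.equivFin ι x : ℕ) / M, ?_, ?_⟩
  · intro x
    set q := (Fintype.equivFin ι x : ℕ) / M with hq
    have : (Finset.Ico (q * M) (q * M + M)).card = M := by simp
    refine le_trans ?_ this.le
    refine Finset.card_le_card_of_injOn (fun x' => (Fintype.equivFin ι x' : ℕ)) ?_ ?_
    · intro x' hx'
      have h1 : (Fintype.equivFin ι x' : ℕ) / M = q := (Finset.mem_filter.1 hx').2
      have h2 := Nat.div_mul_le_self (Fintype.equivFin ι x' : ℕ) M
      have h3 := Nat.lt_div_mul_add (a := (Fintype.equivFin ι x' : ℕ)) hM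
      rw [h1] at h2 h3
      simp only [Finset.coe_Ico, Set.mem_Ico]
      exact ⟨h2, h3⟩
    · intro x1 _ x2 _ h
      exact (Fintype.equivFin ι).injective (Fin.ext h)
  · intro x
    exact Nat.lt_succ_of_le (Nat.div_le_div_right (Fintype.equivFin ι x).2.le)

lemma core (k Δ r : ℕ) (hk : 2 ≤ k) (ϱ μ : ℝ) (hϱ : 0 < ϱ) (hϱ1 : ϱ ≤ 1) (hμ : 0 < μ) :
    ∃ (n₀ : ℕ) (ε₀ : ℝ), 0 < ε₀ ∧
      ∀ ε : ℝ, 0 < ε → ε ≤ ε₀ → ∀ n : ℕ, n₀ ≤ n →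
      ∀ H : Finset (Finset (Fin n)), Typ H (k - 1) ϱ ε n →
      ∀ T : Finset (Finset (Fin n)), (∀ e ∈ T, e.card = k) → (∀ v, vdeg T v ≤ Δ) →
      ∀ rk : Fin n → ℕ, Function.Injective rk →
      (∀ e ∈ T, ∀ e' ∈ T, ∀ v, v ∈ e → v ∈ e' → (∀ w ∈ e, rk w ≤ rk v) →
        (∀ w ∈ e', rk w ≤ rk v) → e = e') →
      ∀ I : Finset (Fin n), (∀ x ∈ I, vdeg T x = r) →
      (∀ x ∈ I, ∀ x' ∈ I, ∀ y, ∀ e ∈ T, ∀ e' ∈ T, x ∈ e → y ∈ e → x' ∈ e' → y ∈ e' → x = x') →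
      μ * n ≤ I.card → ∃ φ : Fin n → Fin n, Function.Injective φ ∧ ∀ e ∈ T, e.image φ ∈ H := by
  obtain ⟨c1, hc1, hV1ev⟩ := exists_V1 (k - 1) ϱ (μ / 2) hϱ hϱ1 (by positivity)
  obtain ⟨p, hp⟩ : ∃ p, p = ϱ ^ r := ⟨_, rfl⟩
  have hp0 : 0 < p := by rw [hp]; positivity
  have hp1 : p ≤ 1 := by rw [hp]; exact pow_le_one₀ hϱ.le hϱ1
  obtain ⟨δ, hδ⟩ : ∃ δ, δ = ϱ * μ / 4 := ⟨_, rfl⟩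
  have hδ0 : 0 < δ := by rw [hδ]; positivity
  obtain ⟨s, hs⟩ : ∃ s, s = p * c1 / 4 := ⟨_, rfl⟩
  have hs0 : 0 < s := by rw [hs]; positivity
  obtain ⟨c, hc0, hcle, hcc1⟩ : ∃ c : ℝ, 0 < c ∧ c ≤ 1 ∧ c ≤ c1 / 4 :=
    ⟨min 1 (c1 / 4), lt_min one_pos (by positivity), min_le_left _ _, min_le_right _ _⟩
  obtain ⟨κ, hκ0, hκμ, hκr⟩ : ∃ κ : ℝ, 0 < κ ∧ κ ≤ μ ∧ r * κ ≤ s / 2 := by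
    refine ⟨min μ (s / (2 * (r + 1))), lt_min hμ (by positivity), min_le_left _ _, ?_⟩
    have h1 : r * min μ (s / (2 * (r + 1))) ≤ (r + 1) * (s / (2 * (r + 1))) := by
      apply mul_le_mul (by linarith) (min_le_right _ _) _ (by positivity)
      exact (lt_min hμ (by positivity)).le
    have h2 : (r + 1) * (s / (2 * (r + 1))) = s / 2 := by field_simp
    linarith
  obtain ⟨q, hq⟩ : ∃ q, q = c ^ r / 2 := ⟨_, rfl⟩
  have hq0 : 0 < q := by rw [hq]; positivity
  have hq1 : q ≤ 1 := by
    have : c ^ r ≤ 1 := pow_le_one₀ hc0.le hcle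
    rw [hq]; linarith
  obtain ⟨η, hη⟩ : ∃ η, η = q * (κ / 2) / 2 := ⟨_, rfl⟩
  have hη0 : 0 < η := by rw [hη]; positivity
  obtain ⟨γ2, hγ2⟩ : ∃ γ2, γ2 = p * η := ⟨_, rfl⟩
  have hγ20 : 0 < γ2 := by rw [hγ2]; positivity
  obtain ⟨m0, hm0⟩ : ∃ m0 : ℕ, 2 ≤ m0 * γ2 ^ 2 := by
    refine ⟨⌈2 / γ2 ^ 2⌉₊, ?_⟩
    rw [← div_le_iff₀ (by positivity)]
    exact Nat.le_ceil _
  obtain ⟨M, hM0, hM⟩ : ∃ M : ℕ, 0 < M ∧ (m0 : ℝ) ≤ s / 2 * M := by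
    have h := ((ev_lin m0 (s / 2) (by positivity)).and (Filter.eventually_gt_atTop 0)).exists
    obtain ⟨M, h1, h2⟩ := h
    exact ⟨M, h2, h1⟩
  obtain ⟨γ, hγ0, hγ1, hγδ, hγs, hγγ2⟩ : ∃ γ : ℝ, 0 < γ ∧ γ ≤ 1 ∧ γ ≤ δ ∧ r * γ ≤ s ∧
      12 * r * γ ≤ γ2 ^ 2 := by
    obtain ⟨γ, hγ⟩ : ∃ γ, γ = min (min 1 δ) (min (s / (r + 1)) (γ2 ^ 2 / (12 * (r + 1)))) :=
      ⟨_, rfl⟩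
    have h0 : 0 < γ := by
      rw [hγ]
      exact lt_min (lt_min one_pos hδ0) (lt_min (by positivity) (by positivity))
    have h1 : γ ≤ s / (r + 1) := by
      rw [hγ]; exact (min_le_right _ _).trans (min_le_left _ _)
    have h2 : γ ≤ γ2 ^ 2 / (12 * (r + 1)) := by
      rw [hγ]; exact (min_le_right _ _).trans (min_le_right _ _)
    rw [le_div_iff₀ (by positivity)] at h1 h2
    refine ⟨γ, h0, ?_, ?_, by linarith, by linarith⟩
    · rw [hγ]; exact (min_le_left _ _).trans (min_le_left _ _)
    · rw [hγ]; exact (min_le_left _ _).trans (min_le_right _ _)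
  have hev := hV1ev.and ((exp_count q (κ / 2) hq0 (by positivity) 1).and
    ((ev_lin (Δ * (16 / γ ^ 2)) (s / 2) (by positivity)).and
    ((ev_lin ((M + 2) * (16 / γ ^ 2)) (c1 / 4) (by positivity)).and
    ((ev_lin ((M + 2) * (16 / γ ^ 2) + 1) δ hδ0).and
    ((ev_lin m0 (s / 2) (by positivity)).and
    ((ev_lin 2 κ hκ0).and (Filter.eventually_ge_atTop k)))))))
  obtain ⟨n₀, hn₀⟩ := Filter.eventually_atTop.1 hev
  refine ⟨n₀, min (γ ^ 2 / 24) (ϱ ^ 2 / 2), lt_min (by positivity) (by positivity), ?_⟩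
  intro ε hε0 hε n hn H hT T hTk hTΔ rk hrk hmax I hIr hI hIc
  obtain ⟨hV1n, hexpn, hn1, hn2, hn3, hn4, hn5, hnk⟩ := hn₀ n hn
  have hε1 : ε ≤ γ ^ 2 / 24 := hε.trans (min_le_left _ _)
  have hε2 : ε ≤ ϱ ^ 2 / 2 := hε.trans (min_le_right _ _)
  have hnpos : (0 : ℝ) < n := hT.npos
  obtain ⟨V1, hV1c, hV1⟩ := hV1n H ε hε2 hT
  obtain ⟨τ, P, Q, hτN, hτi, hP, hQ, hPm, hQr, hE1, hE2⟩ :=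
    tree_seq hk T hTk hTΔ rk hrk hmax I hIr hI
  have hIN : I.card + Iᶜ.card = n := by
    have := Finset.card_add_card_compl I
    rwa [Fintype.card_fin] at this
  have hIN' : (I.card : ℝ) + (Iᶜ.card : ℝ) = n := by exact_mod_cast hIN
  obtain ⟨b, hb1, hb2⟩ := card_block (ι := I) M hM0
  have hκn : κ * n ≤ μ * n := mul_le_mul_of_nonneg_right hκμ hnpos.le
  have hfl := Nat.floor_le (show 0 ≤ κ * n by positivity)
  have hfl2 := Nat.lt_floor_add_one (κ * n)
  obtain ⟨I1, -, hI1⟩ := Finset.exists_subset_card_eq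
    (s := (Finset.univ : Finset I)) (n := ⌊κ * n⌋₊) (by
      have h1 : (⌊κ * n⌋₊ : ℝ) ≤ I.card := by linarith
      rw [Finset.card_univ, Fintype.card_coe]
      exact_mod_cast h1)
  have hI1l : κ / 2 * n ≤ (I1.card : ℝ) := by rw [hI1]; linarith
  have hI1u : (r : ℝ) * I1.card ≤ s / 2 * n := by
    have h1 : (r : ℝ) * I1.card ≤ r * (κ * n) := by
      rw [hI1]; exact mul_le_mul_of_nonneg_left hfl (by positivity)
    have h2 : r * κ * n ≤ s / 2 * n := mul_le_mul_of_nonneg_right hκr hnpos.le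
    linarith
  have hV1l : c1 * n ≤ (V1.card : ℝ) := by
    obtain ⟨f, -, hf⟩ := Finset.exists_subset_card_eq
      (s := (Finset.univ : Finset (Fin n))) (n := k - 1) (by
        rw [Finset.card_univ, Fintype.card_fin]; omega)
    refine (hV1 f f hf hf).trans ?_
    exact_mod_cast Finset.card_le_card Finset.inter_subset_left
  have hsc : s ≤ c1 / 4 := by
    rw [hs]; nlinarith
  have hscn : s * n ≤ c1 / 4 * n := mul_le_mul_of_nonneg_right hsc hnpos.le
  let d : PData (Fin n) I :=
    { H := H, K := k - 1, r := r, Δ := Δ, N := Iᶜ.card, M := M, ϱ := ϱ, ε := ε, γ := γ, n := n,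
      c := c, c1 := c1, δ := δ, P := P, Q := Q, V1 := V1, I1 := I1, b := b }
  have hyp : d.Hyp :=
    { typ := hT
      γ0 := hγ0
      γ1 := hγ1
      εγ := by show 24 * ε ≤ γ ^ 2; linarith
      K1 := by show 1 ≤ k - 1; omega
      hP := fun t _ f hf => hP t f hf
      hQ := fun t _ x A hA => hQ t x A hA
      hPm := hPm
      hQr := hQr
      hb := hb1
      hV1 := hV1
      c0 := hc0
      cle := hcle
      hE := by
        show ((r : ℝ) * I1.card + Δ * (16 / γ ^ 2)) + (M + 2) * (16 / γ ^ 2) + c * n ≤ c1 * n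
        have : c * n ≤ c1 / 4 * n := mul_le_mul_of_nonneg_right hcc1 hnpos.le
        have : 0 ≤ c1 * n := by positivity
        linarith
      δ0 := hδ0
      hR := by
        show δ * n + γ * n ≤ ϱ * (n - V1.card - Iᶜ.card)
        have h1 : γ * n ≤ δ * n := mul_le_mul_of_nonneg_right hγδ hnpos.le
        have h2 : ϱ * (μ / 2 * n) ≤ ϱ * (n - V1.card - (Iᶜ.card : ℝ)) :=
          mul_le_mul_of_nonneg_left (by linarith) hϱ.le
        rw [hδ] at *
        linarith
      hE2 := by
        show ((M : ℝ) + 2) * (16 / γ ^ 2) < δ * n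
        linarith }
  obtain ⟨φ, inv⟩ := d.exists_inv hyp (fun _ => ⟨0, by exact_mod_cast hnpos⟩) d.N le_rfl
  obtain ⟨ψ, hψi, hψ⟩ := d.hall_finish hyp inv
    (by
      show Fintype.card I + Iᶜ.card = Fintype.card (Fin n)
      rw [Fintype.card_coe, Fintype.card_fin, hIN]) s η γ2 m0 (Fintype.card I / M + 1)
    (by
      show s * n ≤ ϱ ^ r * V1.card - r * γ * n - (r * I1.card + Δ * (16 / γ ^ 2))
      rw [← hp]
      have h1 : p * (c1 * n) ≤ p * V1.card := mul_le_mul_of_nonneg_left hV1l hp0.le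
      have h2 : r * γ * n ≤ s * n := mul_le_mul_of_nonneg_right hγs hnpos.le
      have h3 : p * (c1 * n) = 4 * (s * n) := by rw [hs]; ring
      have h4 : 0 ≤ s * n := by positivity
      linarith)
    hb2
    (by
      show (m0 : ℝ) * ((Fintype.card I / M + 1 : ℕ) : ℝ) ≤ s * n
      have hM' : (0 : ℝ) < M := by exact_mod_cast hM0
      have h1 : ((Fintype.card I / M : ℕ) : ℝ) ≤ n / M := by
        refine Nat.cast_div_le.trans ?_
        rw [Fintype.card_coe]
        gcongr
        omega
      have h2 : (m0 : ℝ) * ((Fintype.card I / M : ℕ) : ℝ) ≤ s / 2 * M * (n / M) := by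
        apply mul_le_mul hM h1 (by positivity) (by positivity)
      have h3 : s / 2 * M * (n / M) = s / 2 * n := by field_simp
      push_cast at h2 ⊢
      linarith)
    hγ20 hm0 hγγ2 (by show γ2 ≤ ϱ ^ r * η; rw [hγ2, hp])
    (by
      intro h hh
      rw [hη]
      refine hexpn h I1.card hI1l hq1 ?_
      rw [hq, pow_one]
      exact hh)
  have hψN : ∀ x, ∀ t < Iᶜ.card, ψ x ≠ φ t := by
    intro x t ht h
    exact (hψ x).2 (Finset.mem_image.2 ⟨t, Finset.mem_range.2 ht, h.symm⟩)
  have hφi : ∀ t < Iᶜ.card, ∀ t' < Iᶜ.card, φ t = φ t' → t = t' := by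
    intro t ht t' ht' h
    exact inv.inj (Finset.mem_coe.2 (Finset.mem_range.2 ht))
      (Finset.mem_coe.2 (Finset.mem_range.2 ht')) h
  refine ⟨fun v => if h : v ∈ I then ψ ⟨v, h⟩ else φ (τ v), ?_, ?_⟩
  · intro v w hvw
    by_cases hv : v ∈ I <;> by_cases hw : w ∈ I
    · simp only [dif_pos hv, dif_pos hw] at hvw
      exact congrArg Subtype.val (hψi hvw)
    · simp only [dif_pos hv, dif_neg hw] at hvw
      exact (hψN _ _ (hτN w hw) hvw).elim
    · simp only [dif_neg hv, dif_pos hw] at hvw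
      exact (hψN _ _ (hτN v hv) hvw.symm).elim
    · simp only [dif_neg hv, dif_neg hw] at hvw
      exact hτi v hv w hw (hφi _ (hτN v hv) _ (hτN w hw) hvw)
  · intro e he
    set Φ : Fin n → Fin n := fun v => if h : v ∈ I then ψ ⟨v, h⟩ else φ (τ v) with hΦ
    have hΦ1 : ∀ v ∉ I, Φ v = φ (τ v) := fun v hv => by simp [hΦ, hv]
    have hΦ2 : ∀ x : I, Φ x.1 = ψ x := fun x => by simp [hΦ]
    have himg : ∀ e' : Finset (Fin n), (∀ x ∈ I, x ∉ e') → e'.image Φ = (e'.image τ).image φ := by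
      intro e' he'
      rw [Finset.image_image]
      apply Finset.image_congr
      intro v hv
      exact hΦ1 v fun h => he' v h hv
    by_cases hx : ∃ x ∈ I, x ∈ e
    · obtain ⟨x, hxI, hxe⟩ := hx
      obtain ⟨t, ht, A, hA, heq⟩ := hE2 e he ⟨x, hxI⟩ hxe
      have h1 : (e.erase x).image Φ = insert (φ t) (A.image φ) := by
        rw [himg]
        · simp only at heq
          rw [heq, Finset.image_insert]
        · intro x' hx' h
          rw [Finset.mem_erase] at h
          exact h.1 (hI x' hx' x hxI x e he e he h.2 hxe hxe hxe)
      have h2 := (hψ ⟨x, hxI⟩).1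
      unfold PData.NX at h2
      rw [Finset.mem_filter] at h2
      have h3 := h2.2 t ht A hA
      rw [mem_Nb] at h3
      rw [← Finset.insert_erase hxe, Finset.image_insert, h1, hΦ2 ⟨x, hxI⟩]
      exact h3
    · push Not at hx
      obtain ⟨t, ht, f, hf, heq⟩ := hE1 e he hx
      have h3 := inv.edge t ht f hf
      rw [mem_Nb] at h3
      rw [himg e hx, heq, Finset.image_insert]
      exact h3

/-- For all `k, Δ ≥ 2` and every `ϱ > 0` there exist `n₀` and `ε₀ > 0` such
that for all `ε ≤ ε₀`: every `(ϱ, 2, ε)`-typical `k`-graph on `n ≥ n₀` vertices contains every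
tight `k`-tree on `n` vertices with maximum 1-degree at most `Δ`. -/
theorem spanning_trees_in_typical (k Δ : ℕ) (hk : 2 ≤ k) (hΔ : 2 ≤ Δ) (ϱ : ℝ) (hϱ : 0 < ϱ) :
    ∃ (n₀ : ℕ) (ε₀ : ℝ), 0 < ε₀ ∧
      ∀ ε : ℝ, 0 < ε → ε ≤ ε₀ → ∀ n : ℕ, n₀ ≤ n →
      ∀ H : Finset (Finset (Fin n)), (∀ e ∈ H, e.card = k) →
      (∀ F : Finset (Finset (Fin n)), (∀ f ∈ F, f.card = k - 1) → F.card ≤ 2 →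
        |(jointDeg H F : ℝ) - ϱ ^ F.card * (n : ℝ)| ≤ ε * (n : ℝ)) →
      ∀ T : Finset (Finset (Fin n)), IsTightTree k T → (hverts T).card = n →
      (∀ v, vdeg T v ≤ Δ) →
      Contains H T := by
  have hjd : ∀ (n : ℕ) (H : Finset (Finset (Fin n))) (F : Finset (Finset (Fin n))),
      jointDeg H F = (Finset.univ.filter fun v => ∀ f ∈ F, insert v f ∈ H).card := by
    intro n H F
    unfold jointDeg
    congr
  by_cases hϱ1 : ϱ ≤ 1
  swap
  · push Not at hϱ1
    refine ⟨k, (ϱ - 1) / 2, by linarith, ?_⟩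
    intro ε _ hε n hn H _ hT
    exfalso
    obtain ⟨f, -, hf⟩ := Finset.exists_subset_card_eq
      (s := (Finset.univ : Finset (Fin n))) (n := k - 1) (by
        rw [Finset.card_univ, Fintype.card_fin]; omega)
    have h1 := hT {f} (by intro g hg; rw [Finset.mem_singleton.1 hg, hf]) (by simp)
    have h2 : (jointDeg H {f} : ℝ) ≤ n := by
      have : jointDeg H {f} ≤ n := by
        rw [hjd]
        exact (Finset.card_le_univ _).trans (by rw [Fintype.card_fin])
      exact_mod_cast this
    rw [Finset.card_singleton, pow_one] at h1
    have h3 := (abs_le.1 h1).1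
    have h4 : (0 : ℝ) < n := by
      have : 0 < n := by omega
      exact_mod_cast this
    nlinarith
  obtain ⟨D, hD⟩ : ∃ D : ℕ, D = (Δ + 1) * (Δ * (k * (Δ * k)) + 1) := ⟨_, rfl⟩
  have hD0 : (0 : ℝ) < D := by
    have : 0 < D := by rw [hD]; positivity
    exact_mod_cast this
  choose n₀ ε₀ hε₀ hcore using fun r => core k Δ r hk ϱ (1 / D) hϱ hϱ1 (by positivity)
  refine ⟨max k ((Finset.range (Δ + 1)).sup n₀),
    (Finset.range (Δ + 1)).inf' ⟨0, by simp⟩ ε₀, ?_, ?_⟩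
  · exact (Finset.lt_inf'_iff _).2 fun r _ => hε₀ r
  intro ε hε0 hε n hn H hHk hT T hTT _ hTΔ
  have hnk : k ≤ n := (le_max_left _ _).trans hn
  have hn2 : (Finset.range (Δ + 1)).sup n₀ ≤ n := (le_max_right _ _).trans hn
  obtain ⟨hTk, rk, hrk, hmax⟩ := tree_rank (by omega) T hTT
  obtain ⟨r, hr, I, hIr, hI, hIc⟩ := exists_indep T hTk hTΔ
  have hrm : r ∈ Finset.range (Δ + 1) := Finset.mem_range.2 (by omega)
  have htyp : Typ H (k - 1) ϱ ε n :=
    { hn := by rw [Fintype.card_fin]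
      npos := by
        have : 0 < n := by omega
        exact_mod_cast this
      ϱ0 := hϱ
      ϱ1 := hϱ1
      ε0 := hε0
      one := by
        intro f hf
        have h1 := hT {f} (by intro g hg; rw [Finset.mem_singleton.1 hg, hf]) (by simp)
        rw [Finset.card_singleton, pow_one, hjd] at h1
        convert h1 using 6
        ext v
        simp [mem_Nb]
      two := by
        intro f f' hf hf' hne
        have h1 := hT {f, f'} (by
          intro g hg
          rcases Finset.mem_insert.1 hg with h | h
          · rw [h, hf]
          · rw [Finset.mem_singleton.1 h, hf']) (by
          rw [Finset.card_pair hne])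
        rw [Finset.card_pair hne, hjd] at h1
        convert h1 using 6
        ext v
        simp [mem_Nb] }
  have hIc' : 1 / (D : ℝ) * n ≤ I.card := by
    have h1 : n ≤ I.card * D := by
      rw [hD]
      calc n ≤ _ := hIc
        _ = _ := by ring
    have h2 : (n : ℝ) ≤ I.card * D := by exact_mod_cast h1
    rw [one_div, inv_mul_le_iff₀ hD0]
    linarith
  obtain ⟨φ, hφ, hφe⟩ := hcore r ε hε0 (hε.trans (Finset.inf'_le _ hrm)) n
    ((Finset.le_sup hrm).trans hn2) H htyp T hTk hTΔ rk hrk hmax I hIr hI hIc'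
  refine ⟨φ, hφ, ?_⟩
  intro e he
  convert hφe e he
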